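/- Let R be an order in an imaginary quadratic field Σ and let k be an ideal class of R. For every s > 1, the multiplicity of j(k) as a root of J_s(X,X) equals the number of primitive elements μ of R with norm N(μ) = s, counted up to multiplication by units of R (an element μ ∈ R is primitive if μ/t ∉ R for every rational integer t > 1). -/

import Mathlib

open Polynomial Complex IntermediateField

noncomputable section

/-- 2×2 integer matrices. -/
abbrev Mat : Type := Matrix (Fin 2) (Fin 2) ℤ

/-- The modular group SL₂(ℤ). -/
abbrev SL2Z := Matrix.SpecialLinearGroup (Fin 2) ℤ

/-- A 2×2 integer matrix is primitive if the gcd of its four entries is 1. -/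
def Mat.IsPrimitive (S : Mat) : Prop :=
  Nat.gcd (Nat.gcd (S 0 0).natAbs (S 0 1).natAbs)
    (Nat.gcd (S 1 0).natAbs (S 1 1).natAbs) = 1

/-- Left equivalence of matrices under SL₂(ℤ). -/
def LeftEquiv (S T : Mat) : Prop := ∃ M : SL2Z, S = (M : Mat) * T

/-- Möbius action of an integer matrix on a complex number. -/
def moeb (S : Mat) (z : ℂ) : ℂ :=
  ((S 0 0 : ℂ) * z + (S 0 1 : ℂ)) / ((S 1 0 : ℂ) * z + (S 1 1 : ℂ))

/-- ψ(s) = s·∏_{p∣s}(1+1/p) = Σ_{d∣s squarefree} s/d. -/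
def psi (s : ℕ) : ℕ := ∑ d ∈ s.divisors, if Squarefree d then s / d else 0

/-- Eisenstein series g₂. -/
def g2C (z : ℂ) : ℂ :=
  60 * ∑' w : {v : ℤ × ℤ // v ≠ 0}, ((w.1.1 : ℂ) * z + (w.1.2 : ℂ)) ^ (-4 : ℤ)

/-- Eisenstein series g₃. -/
def g3C (z : ℂ) : ℂ :=
  140 * ∑' w : {v : ℤ × ℤ // v ≠ 0}, ((w.1.1 : ℂ) * z + (w.1.2 : ℂ)) ^ (-6 : ℤ)

/-- The discriminant Δ. -/
def discC (z : ℂ) : ℂ := g2C z ^ 3 - 27 * g3C z ^ 2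

/-- The modular invariant j. -/
def jC (z : ℂ) : ℂ := 1728 * g2C z ^ 3 / discC z

/-- A family of matrices is a complete system of representatives of the left SL₂(ℤ)-orbits
of primitive integer matrices of determinant `s`. -/
def IsOrbitReps (s : ℕ) {n : ℕ} (R : Fin n → Mat) : Prop :=
  (∀ ν, (R ν).IsPrimitive ∧ (R ν).det = (s : ℤ)) ∧
  ∀ T : Mat, T.IsPrimitive → T.det = (s : ℤ) → ∃! ν, LeftEquiv T (R ν)

/-- Evaluation of an integer polynomial at j(z). -/
def evalAtJ (z : ℂ) : Polynomial ℤ →+* ℂ := eval₂RingHom (Int.castRingHom ℂ) (jC z)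

/-- J is the modular polynomial of level s: an element of ℤ[Y][X], monic in X of degree ψ(s),
such that J(X, j(ω)) = ∏_ν (X − j(S_ν ω)) for every ω in the upper half-plane. -/
def IsModularPoly (s : ℕ) (J : Polynomial (Polynomial ℤ)) : Prop :=
  J.Monic ∧ J.natDegree = psi s ∧
  ∀ R : Fin (psi s) → Mat, IsOrbitReps s R → ∀ z : ℂ, 0 < z.im →
    J.map (evalAtJ z) = ∏ ν, (X - C (jC (moeb (R ν) z)))

/-- The one-variable polynomial J(X,X) obtained by setting Y = X. -/
def diagPoly (J : Polynomial (Polynomial ℤ)) : Polynomial ℤ := J.eval Polynomial.X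

/-- φ_S(ω) = s¹²·Δ(Sω)/((cω+d)¹²·Δ(ω)). -/
def phiS (S : Mat) (z : ℂ) : ℂ :=
  (S.det : ℂ) ^ 12 * discC (moeb S z) /
    (((S 1 0 : ℂ) * z + (S 1 1 : ℂ)) ^ 12 * discC z)

/-- K is an imaginary quadratic subfield of ℂ. -/
def IsImagQuad (K : Subfield ℂ) : Prop :=
  ∃ θ : ℂ, 0 < θ.im ∧ Module.finrank ℚ ℚ⟮θ⟯ = 2 ∧ K = ℚ⟮θ⟯.toSubfield

/-- O is an order of the field K: a subring of K which is a finitely generated additive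
group containing a ℚ-basis of K. -/
structure IsOrder (K : Subfield ℂ) (O : Subring ℂ) : Prop where
  le : (O : Set ℂ) ⊆ (K : Set ℂ)
  fg : O.toAddSubgroup.FG
  full : ∀ x ∈ K, ∃ n : ℤ, n ≠ 0 ∧ (n : ℂ) * x ∈ O

/-- The lattice spanned by a and b. -/
def zLat (a b : ℂ) : AddSubgroup ℂ := AddSubgroup.closure {a, b}

/-- (a,b) is a ℤ-basis (with Im(a/b) > 0) of a proper (characteristic) ideal of the
order O of K: the lattice ℤa+ℤb lies in K and its multiplier ring is exactly O. -/
def IsIdealBasis (K : Subfield ℂ) (O : Subring ℂ) (a b : ℂ) : Prop :=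
  0 < (a / b).im ∧ a ∈ K ∧ b ∈ K ∧
  ∀ lam : ℂ, lam ∈ O ↔ (lam * a ∈ zLat a b ∧ lam * b ∈ zLat a b)

/-- Two lattices differ by a nonzero scalar factor. -/
def LatEquiv (A B : AddSubgroup ℂ) : Prop :=
  ∃ μ : ℂ, μ ≠ 0 ∧ (B : Set ℂ) = (fun z => μ * z) '' (A : Set ℂ)

/-- The two ideals with the given bases lie in the same ideal class. -/
def IdealEquiv (a b a' b' : ℂ) : Prop := LatEquiv (zLat a b) (zLat a' b')

/-- Product of two lattices. -/
def latMul (A B : AddSubgroup ℂ) : AddSubgroup ℂ :=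
  AddSubgroup.closure {z : ℂ | ∃ x ∈ A, ∃ y ∈ B, z = x * y}

/-- μ is a primitive element of the order O : μ ∈ O and μ/t ∉ O for every integer t > 1. -/
def IsPrimElem (O : Subring ℂ) (μ : ℂ) : Prop :=
  μ ∈ O ∧ ∀ t : ℤ, 1 < t → μ / (t : ℂ) ∉ O

/-- μ and μ' are associated in O (differ by a unit of O). -/
def UnitAssoc (O : Subring ℂ) (μ μ' : ℂ) : Prop :=
  ∃ ε : ℂ, ε ∈ O ∧ ε ≠ 0 ∧ ε⁻¹ ∈ O ∧ μ' = ε * μ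

/-- The ring of integers of a subfield K of ℂ, as a subring of ℂ. -/
def OK (K : Subfield ℂ) : Subring ℂ := (integralClosure ℤ ℂ).toSubring ⊓ K.toSubring

/-- The index of an order O in the maximal order of K (for a quadratic field this
equals the conductor f of O). -/
def condIndex (K : Subfield ℂ) (O : Subring ℂ) : ℕ :=
  (O.toAddSubgroup.addSubgroupOf (OK K).toAddSubgroup).index

/-- The lattice in ℂ attached to an ideal of the maximal order of K. -/
def idealLat (K : Subfield ℂ) (I : Ideal ↥(OK K)) : AddSubgroup ℂ :=
  AddSubgroup.closure {z : ℂ | ∃ x ∈ I, (x : ℂ) = z}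

/-- The lattice attached to the O-ideal I ∩ O, for an ideal I of the maximal order. -/
def primeOrderLat (K : Subfield ℂ) (O : Subring ℂ) (I : Ideal ↥(OK K)) : AddSubgroup ℂ :=
  AddSubgroup.closure {z : ℂ | z ∈ O ∧ ∃ x ∈ I, (x : ℂ) = z}

/-- The set of all class invariants j(k) of ideal classes of the order O. -/
def classInvSet (K : Subfield ℂ) (O : Subring ℂ) : Set ℂ :=
  {w : ℂ | ∃ a b : ℂ, IsIdealBasis K O a b ∧ w = jC (a / b)}

/-- The ring class field Ω_R : the subfield of ℂ generated by K together with all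
class invariants of the order O. -/
def ringClassField (K : Subfield ℂ) (O : Subring ℂ) : Subfield ℂ :=
  Subfield.closure ((K : Set ℂ) ∪ classInvSet K O)

theorem le_ringClassField (K : Subfield ℂ) (O : Subring ℂ) : K ≤ ringClassField K O :=
  fun _ hx => Subfield.subset_closure (Set.mem_union_left _ hx)

noncomputable instance rcfAlgebra (K : Subfield ℂ) (O : Subring ℂ) :
    Algebra ↥K ↥(ringClassField K O) :=
  (Subfield.inclusion (le_ringClassField K O)).toAlgebra

theorem OK_mono {K L : Subfield ℂ} (h : K ≤ L) : OK K ≤ OK L := by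
  intro x hx
  rw [OK, Subring.mem_inf] at hx ⊢
  exact ⟨hx.1, h hx.2⟩

/-- 𝔭 splits completely in L/K: the extension of 𝔭 to the ring of integers of L is a
product of pairwise distinct primes, each of residue degree one over 𝔭. -/
def SplitsCompletely (K L : Subfield ℂ) (h : K ≤ L) (p : Ideal ↥(OK K)) : Prop :=
  ∃ (g : ℕ) (Q : Fin g → Ideal ↥(OK L)),
    Function.Injective Q ∧ (∀ i, (Q i).IsPrime) ∧
    Ideal.map (Subring.inclusion (OK_mono h)) p = ∏ i, Q i ∧
    ∀ i, Nat.card (↥(OK L) ⧸ Q i) = Nat.card (↥(OK K) ⧸ p)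

/-- L is a finite extension of ℚ (a number field) inside ℂ. -/
def FinDimOverQ (L : Subfield ℂ) : Prop :=
  ∃ t : Finset ℂ, (L : Set ℂ) ⊆ (Submodule.span ℚ (t : Set ℂ) : Submodule ℚ ℂ)

/-- Lattice Eisenstein sums Σ_{w∈L, w≠0} w^{-k}. -/
def gkL (k : ℕ) (L : AddSubgroup ℂ) : ℂ :=
  ∑' w : {w : ℂ // w ∈ L ∧ w ≠ 0}, (w : ℂ) ^ (-(k : ℤ))

def g2L (L : AddSubgroup ℂ) : ℂ := 60 * gkL 4 L
def g3L (L : AddSubgroup ℂ) : ℂ := 140 * gkL 6 L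
def discL (L : AddSubgroup ℂ) : ℂ := g2L L ^ 3 - 27 * g3L L ^ 2

/-- The Weierstrass ℘-function of a lattice. -/
def wpL (z : ℂ) (L : AddSubgroup ℂ) : ℂ :=
  z ^ (-2 : ℤ) + ∑' w : {w : ℂ // w ∈ L ∧ w ≠ 0},
    ((z - (w : ℂ)) ^ (-2 : ℤ) - (w : ℂ) ^ (-2 : ℤ))

/-- The Weber function τ_R(z, 𝔴), where e is the number of units of R. -/
def weber (e : ℕ) (z : ℂ) (L : AddSubgroup ℂ) : ℂ :=
  if e = 4 then 2 ^ 8 * 3 ^ 4 * (g2L L ^ 2 / discL L) * wpL z L ^ 2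
  else if e = 6 then -(2 ^ 9 * 3 ^ 6) * (g3L L / discL L) * wpL z L ^ 3
  else -(2 ^ 7 * 3 ^ 5) * (g2L L * g3L L / discL L) * wpL z L

/-- The number of units (roots of unity) in the ring of integers of K. -/
def numRootsOfUnity (K : Subfield ℂ) : ℕ :=
  Nat.card {x : ℂ // x ∈ OK K ∧ ∃ n : ℕ, 0 < n ∧ x ^ n = 1}

/-- λ ≡ 1 mod* 𝔪 (multiplicative congruence): λ = β/γ with β, γ integral and prime
to 𝔪 and β ≡ γ mod 𝔪. -/
def MulCongOne (K : Subfield ℂ) (m : Ideal ↥(OK K)) (lam : ℂ) : Prop :=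
  ∃ β γ : ↥(OK K), (γ : ℂ) ≠ 0 ∧ lam = (β : ℂ) / (γ : ℂ) ∧
    Ideal.span {β} ⊔ m = ⊤ ∧ Ideal.span {γ} ⊔ m = ⊤ ∧ β - γ ∈ m

/-- The Dedekind eta function. -/
def dedekindEta (z : ℂ) : ℂ :=
  Complex.exp (Real.pi * Complex.I * z / 12) *
    ∏' n : ℕ, (1 - Complex.exp (2 * Real.pi * Complex.I * ((n : ℂ) + 1) * z))

/-- ζ₂₄ = e^{2πi/24}. -/
def zeta24 : ℂ := Complex.exp (2 * Real.pi * Complex.I / 24)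

/-- The image of the basis (a,b) under an integer matrix. -/
def matBasis (P : Mat) (a b : ℂ) : ℂ × ℂ :=
  ((P 0 0 : ℂ) * a + (P 0 1 : ℂ) * b, (P 1 0 : ℂ) * a + (P 1 1 : ℂ) * b)

/-- The image of the basis (a,b) under a rational matrix. -/
def matBasisQ (B : Matrix (Fin 2) (Fin 2) ℚ) (a b : ℂ) : ℂ × ℂ :=
  ((B 0 0 : ℂ) * a + (B 0 1 : ℂ) * b, (B 1 0 : ℂ) * a + (B 1 1 : ℂ) * b)

/-- φ_B for a rational matrix B of positive determinant. -/
def phiQ (B : Matrix (Fin 2) (Fin 2) ℚ) (z : ℂ) : ℂ :=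
  (B.det : ℂ) ^ 12 *
      discC (((B 0 0 : ℂ) * z + (B 0 1 : ℂ)) / ((B 1 0 : ℂ) * z + (B 1 1 : ℂ))) /
    (((B 1 0 : ℂ) * z + (B 1 1 : ℂ)) ^ 12 * discC z)

/-- The lattice attached to the complex conjugate of an ideal of the maximal order. -/
def conjIdealLat (K : Subfield ℂ) (I : Ideal ↥(OK K)) : AddSubgroup ℂ :=
  AddSubgroup.closure {z : ℂ | ∃ x ∈ I, (starRingEnd ℂ) (x : ℂ) = z}

/-- The triangular representatives (a b; 0 d), a·d = s, gcd(a,b,d) = 1, 0 ≤ b < d,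
encoded as triples (a, b, d). -/
def triReps (s : ℕ) : Finset (ℕ × ℕ × ℕ) :=
  (Finset.range (s + 1) ×ˢ Finset.range (s + 1) ×ˢ Finset.range (s + 1)).filter
    (fun t => 0 < t.1 ∧ 0 < t.2.2 ∧ t.1 * t.2.2 = s ∧
      Nat.gcd t.1 (Nat.gcd t.2.1 t.2.2) = 1 ∧ t.2.1 < t.2.2)

open Filter Topology in
/-- Near the origin, `℘` is determined by the invariants `g₂` and `g₃`. -/
theorem weierstrassPExcept_zero_eventuallyEq {L L' : PeriodPair} (h2 : L.g₂ = L'.g₂)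
    (h3 : L.g₃ = L'.g₃) :
    L.weierstrassPExcept 0 =ᶠ[𝓝 0] L'.weierstrassPExcept 0 := by
  set f := L.weierstrassPExcept 0
  set g := L'.weierstrassPExcept 0
  have hf : AnalyticAt ℂ f 0 := L.analyticAt_weierstrassPExcept 0
  have hg : AnalyticAt ℂ g 0 := L'.analyticAt_weierstrassPExcept 0
  set f' := L.derivWeierstrassPExcept 0
  set g' := L'.derivWeierstrassPExcept 0
  have hf' : AnalyticAt ℂ f' 0 := L.analyticAt_derivWeierstrassPExcept 0
  have hg' : AnalyticAt ℂ g' 0 := L'.analyticAt_derivWeierstrassPExcept 0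
  have hD : AnalyticAt ℂ (f - g) 0 := hf.sub hg
  by_contra hne
  have hord : analyticOrderAt (f - g) 0 ≠ ⊤ := by
    rw [Ne, analyticOrderAt_eq_top]
    intro h
    exact hne (h.mono fun z hz => sub_eq_zero.mp hz)
  obtain ⟨k, hk, hk0, hfk⟩ := hD.analyticOrderAt_ne_top.mp hord
  set n := analyticOrderNatAt (f - g) 0
  have hLn : ∀ᶠ z in 𝓝[≠] (0:ℂ), z ∈ (L.lattice : Set ℂ)ᶜ ∧ z ∈ (L'.lattice : Set ℂ)ᶜ := by
    filter_upwards [self_mem_nhdsWithin,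
      mem_nhdsWithin_of_mem_nhds (L.compl_lattice_sdiff_singleton_mem_nhds 0),
      mem_nhdsWithin_of_mem_nhds (L'.compl_lattice_sdiff_singleton_mem_nhds 0)] with z hz h1 h2
    simp_all
  have hderiv : ∀ᶠ z in 𝓝[≠] (0:ℂ),
      f' z - g' z = (n * z ^ (n - 1) * k z + z ^ n * deriv k z) := by
    have h1 : ∀ᶠ z in 𝓝 (0:ℂ), deriv (f - g) z = deriv (fun z => z ^ n * k z) z := by
      refine EventuallyEq.deriv ?_
      filter_upwards [hfk] with z hz
      simpa using hz
    filter_upwards [mem_nhdsWithin_of_mem_nhds h1,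
      mem_nhdsWithin_of_mem_nhds hk.eventually_analyticAt,
      mem_nhdsWithin_of_mem_nhds hf.eventually_analyticAt,
      mem_nhdsWithin_of_mem_nhds hg.eventually_analyticAt,
      mem_nhdsWithin_of_mem_nhds (L.compl_lattice_sdiff_singleton_mem_nhds 0),
      mem_nhdsWithin_of_mem_nhds (L'.compl_lattice_sdiff_singleton_mem_nhds 0)]
      with z hz hkz hfz hgz hl hl'
    rw [deriv_sub hfz.differentiableAt hgz.differentiableAt,
      L.eqOn_deriv_weierstrassPExcept_derivWeierstrassPExcept 0 hl,
      L'.eqOn_deriv_weierstrassPExcept_derivWeierstrassPExcept 0 hl',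
      deriv_fun_mul (by fun_prop) hkz.differentiableAt] at hz
    simpa [f', g'] using hz
  let A : ℂ → ℂ := fun z => z ^ 3 * (f' z + g' z) - 4
  let B : ℂ → ℂ := fun z => 4 * ((1 + z ^ 2 * f z) ^ 2 + (1 + z ^ 2 * f z) * (1 + z ^ 2 * g z)
    + (1 + z ^ 2 * g z) ^ 2) - L.g₂ * z ^ 4
  have key : ∀ᶠ z in 𝓝[≠] (0:ℂ), (n * k z + z * deriv k z) * A z = k z * B z := by
    filter_upwards [self_mem_nhdsWithin, hLn, hderiv, mem_nhdsWithin_of_mem_nhds hfk]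
      with z hz hl hd hfg
    have hz : z ≠ 0 := hz
    have e1 := L.derivWeierstrassP_sq z hl.1
    have e2 := L'.derivWeierstrassP_sq z hl.2
    have p1 : L.weierstrassP z = f z + 1 / z ^ 2 := by
      have := L.weierstrassPExcept_def 0 z
      simp at this; simp [f, this]
    have p2 : L'.weierstrassP z = g z + 1 / z ^ 2 := by
      have := L'.weierstrassPExcept_def 0 z
      simp at this; simp [g, this]
    have q1 : L.derivWeierstrassP z = f' z - 2 / z ^ 3 := by
      have := L.derivWeierstrassPExcept_def 0 z
      simp at this; simp [f', this]
    have q2 : L'.derivWeierstrassP z = g' z - 2 / z ^ 3 := by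
      have := L'.derivWeierstrassPExcept_def 0 z
      simp at this; simp [g', this]
    rw [p1, q1] at e1
    rw [p2, q2, ← h2, ← h3] at e2
    simp only [Pi.sub_apply, sub_zero, smul_eq_mul] at hfg
    have hzn : z ^ n ≠ 0 := pow_ne_zero _ hz
    have hnk : z * (f' z - g' z) = z ^ n * (n * k z + z * deriv k z) := by
      rw [hd]
      rcases n with _ | n
      · simp
      · simp [pow_succ]; ring
    have e3 : z * (f' z - g' z) * A z = (f z - g z) * B z := by
      have e4 : (f' z - 2 / z ^ 3) ^ 2 - (g' z - 2 / z ^ 3) ^ 2 =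
        4 * (f z + 1 / z ^ 2) ^ 3 - L.g₂ * (f z + 1 / z ^ 2) - (4 * (g z + 1 / z ^ 2) ^ 3 -
          L.g₂ * (g z + 1 / z ^ 2)) := by rw [e1, e2]; ring
      have a1 : A z = z ^ 3 * ((f' z - 2 / z ^ 3) + (g' z - 2 / z ^ 3)) := by
        simp only [A]; field_simp; ring
      have b1 : B z = z ^ 4 * (4 * ((f z + 1 / z ^ 2) ^ 2 + (f z + 1 / z ^ 2) * (g z + 1 / z ^ 2) +
        (g z + 1 / z ^ 2) ^ 2) - L.g₂) := by
        simp only [B]; field_simp; ring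
      rw [a1, b1]
      linear_combination z ^ 4 * e4
    rw [hnk, hfg] at e3
    apply mul_left_cancel₀ hzn
    linear_combination e3
  have hcA : ContinuousAt A 0 := by
    have := hf'.continuousAt; have := hg'.continuousAt
    simp only [A]; fun_prop
  have hcB : ContinuousAt B 0 := by
    have := hf.continuousAt; have := hg.continuousAt
    simp only [B]; fun_prop
  have hck := hk.continuousAt
  have hck' := hk.deriv.continuousAt
  have hl : ContinuousAt (fun z => (n * k z + z * deriv k z) * A z) 0 := by fun_prop
  have hr : ContinuousAt (fun z => k z * B z) 0 := by fun_prop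
  have := tendsto_nhds_unique_of_eventuallyEq (hl.tendsto.mono_left nhdsWithin_le_nhds)
    (hr.tendsto.mono_left nhdsWithin_le_nhds) key
  simp [A, B] at this
  have h4 : k 0 * ((n + 3 : ℕ) : ℂ) = 0 := by push_cast; linear_combination -this / 4
  rcases mul_eq_zero.mp h4 with h | h
  · exact hk0 h
  · exact absurd (Nat.cast_eq_zero.mp h) (by omega)

open Filter Topology in
theorem lattice_le_of_g₂_eq_of_g₃_eq {L L' : PeriodPair} (h2 : L.g₂ = L'.g₂)
    (h3 : L.g₃ = L'.g₃) : L.lattice ≤ L'.lattice := by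
  let S : Set ℂ := (L.lattice : Set ℂ) ∪ L'.lattice
  have hcount : S.Countable := by
    apply Set.Countable.union
    · exact (inferInstance : Countable L.lattice)
    · exact (inferInstance : Countable L'.lattice)
  have hconn : IsPreconnected Sᶜ :=
    (hcount.isConnected_compl_of_one_lt_rank (by simp)).isPreconnected
  have hS : IsClosed S := L.isClosed_lattice.union L'.isClosed_lattice
  have ha : AnalyticOnNhd ℂ L.weierstrassP Sᶜ :=
    L.analyticOnNhd_weierstrassP.mono (by simp [S])
  have ha' : AnalyticOnNhd ℂ L'.weierstrassP Sᶜ :=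
    L'.analyticOnNhd_weierstrassP.mono (by simp [S])
  have hnear : ∀ x : ℂ, ∀ᶠ z in 𝓝[≠] x, z ∈ Sᶜ := by
    intro x
    filter_upwards [self_mem_nhdsWithin,
      mem_nhdsWithin_of_mem_nhds (L.compl_lattice_sdiff_singleton_mem_nhds x),
      mem_nhdsWithin_of_mem_nhds (L'.compl_lattice_sdiff_singleton_mem_nhds x)] with z hz h1 h2
    simp_all [S]
  have hloc : ∀ᶠ z in 𝓝 (0:ℂ), L.weierstrassP z = L'.weierstrassP z := by
    filter_upwards [weierstrassPExcept_zero_eventuallyEq h2 h3] with z hz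
    have e1 := L.weierstrassPExcept_def 0 z
    have e2 := L'.weierstrassPExcept_def 0 z
    simp only [ZeroMemClass.coe_zero] at e1 e2
    rw [e1, e2] at hz
    simpa using hz
  obtain ⟨z₀, hz₀, hz₀'⟩ := ((hnear 0).and
    (mem_nhdsWithin_of_mem_nhds hloc.eventually_nhds)).exists
  have heq : Set.EqOn L.weierstrassP L'.weierstrassP Sᶜ :=
    ha.eqOn_of_preconnected_of_eventuallyEq ha' hconn hz₀ hz₀'
  intro l hl
  by_contra hl'
  have o1 := L.order_weierstrassP l hl
  have o2 : 0 ≤ meromorphicOrderAt L'.weierstrassP l :=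
    (L'.analyticOnNhd_weierstrassP l hl').meromorphicOrderAt_nonneg
  rw [← meromorphicOrderAt_congr ((hnear l).mono heq), o1] at o2
  exact absurd o2 (by decide)

/-- A lattice is determined by the invariants `g₂` and `g₃`. -/
theorem lattice_eq_of_g₂_eq_of_g₃_eq {L L' : PeriodPair} (h2 : L.g₂ = L'.g₂)
    (h3 : L.g₃ = L'.g₃) : L.lattice = L'.lattice :=
  le_antisymm (lattice_le_of_g₂_eq_of_g₃_eq h2 h3) (lattice_le_of_g₂_eq_of_g₃_eq h2.symm h3.symm)

/-- The full lattice sum of even weight `k ≥ 3` over nonzero pairs in terms of the normalised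
Eisenstein series. -/
theorem tsum_ne_zero_zpow_eq_E {k : ℕ} (hk : 3 ≤ k) (z : UpperHalfPlane) :
    ∑' w : {v : ℤ × ℤ // v ≠ 0}, ((w.1.1 : ℂ) * z + (w.1.2 : ℂ)) ^ (-(k : ℤ)) =
      2 * riemannZeta k * ModularForm.E hk z := by
  have h1 := tsum_eisSummand_eq_riemannZeta_mul_eisensteinSeries hk z
  have h2 : ModularForm.E hk z = (1 / 2 : ℂ) * eisensteinSeries (N := 1) 0 k z := rfl
  rw [h2, show 2 * riemannZeta k * ((1 / 2 : ℂ) * eisensteinSeries (N := 1) 0 k z) =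
    riemannZeta k * eisensteinSeries (N := 1) 0 k z by ring, ← h1,
    ← (finTwoArrowEquiv ℤ).symm.tsum_eq]
  have h3 := tsum_subtype_eq_of_support_subset (s := {v : ℤ × ℤ | v ≠ 0})
    (f := fun v : ℤ × ℤ => ((v.1 : ℂ) * z + (v.2 : ℂ)) ^ (-(k : ℤ))) (by
      intro v hv h0
      apply hv
      subst h0
      simp
      omega)
  refine h3.trans ?_
  simp [EisensteinSeries.eisSummand]

theorem riemannZeta_six : riemannZeta 6 = Real.pi ^ 6 / 945 := by
  have h := riemannZeta_two_mul_nat (k := 3) (by norm_num)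
  have hb : _root_.bernoulli 6 = 1 / 42 := by
    rw [bernoulli_eq_bernoulli'_of_ne_one (by norm_num)]
    have h5 : bernoulli' 5 = 0 := by
      norm_num [bernoulli'_def 5, Finset.sum_range_succ, Nat.choose]
    rw [bernoulli'_def]
    norm_num [Finset.sum_range_succ, Nat.choose, h5]
  norm_num [hb, Nat.factorial] at h
  rw [h]; ring

theorem g2C_eq (z : UpperHalfPlane) : g2C z = 4 * Real.pi ^ 4 / 3 * ModularForm.E₄ z := by
  have h := tsum_ne_zero_zpow_eq_E (by norm_num : 3 ≤ 4) z
  norm_num [riemannZeta_four] at h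
  rw [g2C]
  norm_num
  rw [h]; ring

theorem g3C_eq (z : UpperHalfPlane) : g3C z = 8 * Real.pi ^ 6 / 27 * ModularForm.E₆ z := by
  have h := tsum_ne_zero_zpow_eq_E (by norm_num : 3 ≤ 6) z
  norm_num [riemannZeta_six] at h
  rw [g3C]
  norm_num
  rw [h]; ring

theorem discC_eq (z : UpperHalfPlane) :
    discC z = 4096 * Real.pi ^ 12 * ModularForm.discriminant z := by
  rw [discC, g2C_eq, g3C_eq, ModularForm.discriminant_eq_E₄_cube_sub_E₆_sq]
  ring

theorem discC_ne_zero {z : ℂ} (hz : 0 < z.im) : discC z ≠ 0 := by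
  have := discC_eq ⟨z, hz⟩
  change discC z = _ at this
  rw [this]
  have := ModularForm.discriminant_ne_zero ⟨z, hz⟩
  have := Real.pi_ne_zero
  simp_all

theorem jC_eq (z : UpperHalfPlane) :
    jC z = ModularForm.E₄ z ^ 3 / ModularForm.discriminant z := by
  have h1 := ModularForm.discriminant_ne_zero z
  have h2 : (Real.pi : ℂ) ≠ 0 := by exact_mod_cast Real.pi_ne_zero
  rw [jC, discC_eq, g2C_eq]
  field_simp
  ring

theorem differentiableOn_jC : DifferentiableOn ℂ jC {z | 0 < z.im} := by
  have h4 := (UpperHalfPlane.mdifferentiable_iff.mp ModularForm.E₄.holo')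
  have hd := (UpperHalfPlane.mdifferentiable_iff.mp CuspForm.discriminant.holo')
  refine ((h4.pow 3).div hd ?_).congr ?_
  · intro z hz
    have := ModularForm.discriminant_ne_zero ⟨z, hz⟩
    simpa [UpperHalfPlane.ofComplex_apply_of_im_pos hz] using this
  · intro z hz
    have := jC_eq ⟨z, hz⟩
    simpa [UpperHalfPlane.ofComplex_apply_of_im_pos hz] using this

theorem analyticAt_jC {z : ℂ} (hz : 0 < z.im) : AnalyticAt ℂ jC z :=
  differentiableOn_jC.analyticAt ((isOpen_lt continuous_const continuous_im).mem_nhds hz)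

theorem coe_smul_eq_moeb (M : SL2Z) (z : UpperHalfPlane) : ((M • z : UpperHalfPlane) : ℂ) =
    moeb M z := by
  rw [UpperHalfPlane.coe_specialLinearGroup_apply]
  simp [moeb]

theorem jC_moeb (M : SL2Z) {z : ℂ} (hz : 0 < z.im) : jC (moeb M z) = jC z := by
  have h := coe_smul_eq_moeb M ⟨z, hz⟩
  change _ = moeb M z at h
  rw [← h, jC_eq]
  have h' := jC_eq ⟨z, hz⟩
  change jC z = _ at h'
  rw [h']
  have h4 := SlashInvariantForm.slash_action_eqn'' ModularForm.E₄ (γ := (M : GL (Fin 2) ℝ))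
    (by simpa using ⟨M, rfl⟩) ⟨z, hz⟩
  have hd := SlashInvariantForm.slash_action_eqn'' CuspForm.discriminant (γ := (M : GL (Fin 2) ℝ))
    (by simpa using ⟨M, rfl⟩) ⟨z, hz⟩
  have hden := UpperHalfPlane.denom_ne_zero (M : GL (Fin 2) ℝ) ⟨z, hz⟩
  change ModularForm.E₄ (M • _) = _ at h4
  change ModularForm.discriminant (M • _) = _ at hd
  rw [h4, hd]
  have := ModularForm.discriminant_ne_zero ⟨z, hz⟩
  simp only [CuspForm.coe_discriminant]
  field_simp

/-- The period pair `(c z, c)`. -/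
def scaledPeriodPair (z c : ℂ) (hz : 0 < z.im) (hc : c ≠ 0) : PeriodPair where
  ω₁ := c * z
  ω₂ := c
  indep := by
    rw [LinearIndependent.pair_iff]
    intro s t h
    have h1 : (s : ℂ) * z + t = 0 := by
      have : c * (s * z + t) = 0 := by
        simp only [real_smul] at h
        linear_combination h
      exact (mul_eq_zero.mp this).resolve_left hc
    have h2 : s = 0 := by
      have := congrArg im h1
      simpa [hz.ne'] using this
    subst h2
    simpa using h1

theorem scaledPeriodPair_G (z c : ℂ) (hz : 0 < z.im) (hc : c ≠ 0) {k : ℕ} (hk : k ≠ 0) :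
    (scaledPeriodPair z c hz hc).G k = (c ^ k)⁻¹ *
      ∑' w : {v : ℤ × ℤ // v ≠ 0}, ((w.1.1 : ℂ) * z + (w.1.2 : ℂ)) ^ (-(k : ℤ)) := by
  rw [PeriodPair.G, ← (scaledPeriodPair z c hz hc).latticeEquivProd.symm.toEquiv.tsum_eq,
    ← tsum_mul_left]
  have h3 := tsum_subtype_eq_of_support_subset (s := {v : ℤ × ℤ | v ≠ 0})
    (f := fun v : ℤ × ℤ => (c ^ k)⁻¹ * ((v.1 : ℂ) * z + (v.2 : ℂ)) ^ (-(k : ℤ))) (by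
      intro v hv h0
      apply hv
      subst h0
      simp [hk])
  refine Eq.trans ?_ h3.symm
  refine tsum_congr fun v => ?_
  have : (((scaledPeriodPair z c hz hc).latticeEquivProd.symm.toEquiv v :
      (scaledPeriodPair z c hz hc).lattice) : ℂ) = c * (v.1 * z + v.2) := by
    refine ((scaledPeriodPair z c hz hc).latticeEquiv_symm_apply v).trans ?_
    simp only [scaledPeriodPair]
    ring
  rw [this, mul_pow, mul_inv, zpow_neg, zpow_natCast]

theorem scaledPeriodPair_g₂ (z c : ℂ) (hz : 0 < z.im) (hc : c ≠ 0) :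
    (scaledPeriodPair z c hz hc).g₂ = (c ^ 4)⁻¹ * g2C z := by
  rw [PeriodPair.g₂, scaledPeriodPair_G z c hz hc (by norm_num), g2C]
  push_cast
  ring

theorem scaledPeriodPair_g₃ (z c : ℂ) (hz : 0 < z.im) (hc : c ≠ 0) :
    (scaledPeriodPair z c hz hc).g₃ = (c ^ 6)⁻¹ * g3C z := by
  rw [PeriodPair.g₃, scaledPeriodPair_G z c hz hc (by norm_num), g3C]
  push_cast
  ring

theorem exists_scaling {A B A' B' : ℂ} (hD : A ^ 3 - 27 * B ^ 2 ≠ 0)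
    (hD' : A' ^ 3 - 27 * B' ^ 2 ≠ 0)
    (h : A ^ 3 / (A ^ 3 - 27 * B ^ 2) = A' ^ 3 / (A' ^ 3 - 27 * B' ^ 2)) :
    ∃ c : ℂ, c ≠ 0 ∧ A' = c ^ 4 * A ∧ B' = c ^ 6 * B := by
  rw [div_eq_div_iff hD hD'] at h
  have h : A' ^ 3 * B ^ 2 = A ^ 3 * B' ^ 2 := by linear_combination h / 27
  by_cases hA : A = 0
  · have hB : B ≠ 0 := by rintro rfl; simp [hA] at hD
    have hA' : A' = 0 := by simpa [hA, hB] using h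
    have hB' : B' ≠ 0 := by rintro rfl; simp [hA'] at hD'
    obtain ⟨c, hc⟩ := IsAlgClosed.exists_pow_nat_eq (B' / B) (n := 6) (by norm_num)
    refine ⟨c, ?_, by simp [hA, hA'], by rw [hc]; field_simp⟩
    rintro rfl
    have := div_ne_zero hB' hB
    simp [← hc] at this
  have hA' : A' ≠ 0 := by
    rintro rfl
    have : B' = 0 := by simpa [hA] using h.symm
    simp [this] at hD'
  obtain ⟨c, hc⟩ := IsAlgClosed.exists_pow_nat_eq (A' / A) (n := 4) (by norm_num)
  have hc0 : c ≠ 0 := by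
    rintro rfl
    have := div_ne_zero hA' hA
    simp [← hc] at this
  have h1 : A' = c ^ 4 * A := by rw [hc]; field_simp
  have h2 : (c ^ 6 * B - B') * (c ^ 6 * B + B') = 0 := by
    have : A ^ 3 * ((c ^ 6 * B - B') * (c ^ 6 * B + B')) = 0 := by
      rw [h1] at h
      linear_combination h
    simpa [hA] using this
  rcases mul_eq_zero.mp h2 with h2 | h2
  · exact ⟨c, hc0, h1, (sub_eq_zero.mp h2).symm⟩
  · refine ⟨I * c, mul_ne_zero I_ne_zero hc0, ?_, ?_⟩
    · rw [mul_pow, I_pow_four, one_mul, h1]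
    · have : I ^ 6 = -1 := by
        rw [show (6 : ℕ) = 4 + 2 by norm_num, pow_add, I_pow_four, I_sq]; ring
      rw [mul_pow, this]
      linear_combination h2

theorem exists_smul_eq_of_mem_lattice {L L' : PeriodPair} (h : L.lattice = L'.lattice) :
    ∃ S : Mat, L'.ω₁ = S 0 0 * L.ω₁ + S 0 1 * L.ω₂ ∧ L'.ω₂ = S 1 0 * L.ω₁ + S 1 1 * L.ω₂ := by
  obtain ⟨p, q, h1⟩ := PeriodPair.mem_lattice.mp (h ▸ L'.ω₁_mem_lattice)
  obtain ⟨r, t, h2⟩ := PeriodPair.mem_lattice.mp (h ▸ L'.ω₂_mem_lattice)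
  exact ⟨!![p, q; r, t], by simp [h1], by simp [h2]⟩

theorem moeb_im (S : Mat) (z : ℂ) :
    (moeb S z).im = S.det * z.im / normSq (S 1 0 * z + S 1 1) := by
  rw [moeb, div_im, Matrix.det_fin_two, ← sub_div]
  simp
  ring

theorem int_mul_add_eq_zero {z : ℂ} (hz : 0 < z.im) {p q : ℤ} (h : (p : ℂ) * z + q = 0) :
    p = 0 ∧ q = 0 := by
  have hp : p = 0 := by
    have := congrArg im h
    simpa [hz.ne'] using this
  subst hp
  simpa using h

theorem mat_eq_of_mulVec_eq {z : ℂ} (hz : 0 < z.im) {S T : Mat}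
    (h0 : (S 0 0 : ℂ) * z + S 0 1 = T 0 0 * z + T 0 1)
    (h1 : (S 1 0 : ℂ) * z + S 1 1 = T 1 0 * z + T 1 1) : S = T := by
  have e0 := int_mul_add_eq_zero hz (p := S 0 0 - T 0 0) (q := S 0 1 - T 0 1)
    (by push_cast; linear_combination h0)
  have e1 := int_mul_add_eq_zero hz (p := S 1 0 - T 1 0) (q := S 1 1 - T 1 1)
    (by push_cast; linear_combination h1)
  ext i j
  fin_cases i <;> fin_cases j <;> simp <;> omega

/-- The modular invariant separates `SL₂(ℤ)`-orbits. -/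
theorem exists_moeb_eq_of_jC_eq {z w : ℂ} (hz : 0 < z.im) (hw : 0 < w.im) (h : jC z = jC w) :
    ∃ M : SL2Z, moeb M z = w := by
  have hD := discC_ne_zero hz
  have hD' := discC_ne_zero hw
  obtain ⟨c, hc, h2, h3⟩ := exists_scaling (A := g2C z) (B := g3C z) (A' := g2C w) (B' := g3C w)
    hD hD' (by
      simp only [jC, mul_div_assoc] at h
      exact mul_left_cancel₀ (by norm_num) h)
  set L := scaledPeriodPair z c⁻¹ hz (inv_ne_zero hc) with hL
  set L' := scaledPeriodPair w 1 hw one_ne_zero with hL'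
  have hLL : L.lattice = L'.lattice := by
    apply lattice_eq_of_g₂_eq_of_g₃_eq
    · rw [hL, hL', scaledPeriodPair_g₂, scaledPeriodPair_g₂, h2]; simp
    · rw [hL, hL', scaledPeriodPair_g₃, scaledPeriodPair_g₃, h3]; simp
  obtain ⟨S, hS1, hS2⟩ := exists_smul_eq_of_mem_lattice hLL
  obtain ⟨T, hT1, hT2⟩ := exists_smul_eq_of_mem_lattice hLL.symm
  simp only [hL, hL', scaledPeriodPair, one_mul, mul_one] at hS1 hS2 hT1 hT2
  have hS1 : c * w = S 0 0 * z + S 0 1 := by rw [hS1]; field_simp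
  have hS2 : c = S 1 0 * z + S 1 1 := by
    have := congrArg (c * ·) hS2; field_simp at this; exact this
  have hT1 : z = c * (T 0 0 * w + T 0 1) := by rw [← hT1]; field_simp
  have hT2 : 1 = c * (T 1 0 * w + T 1 1) := by rw [← hT2]; field_simp
  have hTS : T * S = 1 := by
    apply mat_eq_of_mulVec_eq hz
    · simp [Matrix.mul_apply, Fin.sum_univ_two]
      linear_combination -hT1 - T 0 0 * hS1 - T 0 1 * hS2
    · simp [Matrix.mul_apply, Fin.sum_univ_two]
      linear_combination -hT2 - T 1 0 * hS1 - T 1 1 * hS2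
  have hm : moeb S z = w := by rw [moeb, ← hS1, ← hS2]; field_simp
  have hdet : 0 < S.det := by
    have := moeb_im S z
    rw [hm, ← hS2] at this
    have hn : 0 < normSq c := normSq_pos.mpr hc
    have h0 : (0 : ℝ) < S.det := by
      by_contra! hneg
      have : w.im ≤ 0 := by
        rw [this]
        exact div_nonpos_of_nonpos_of_nonneg (mul_nonpos_of_nonpos_of_nonneg hneg hz.le) hn.le
      linarith
    exact_mod_cast h0
  have h1 : S.det = 1 := by
    have hu : IsUnit S.det := IsUnit.of_mul_eq_one T.det (by
      rw [mul_comm, ← Matrix.det_mul, hTS, Matrix.det_one])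
    rcases Int.isUnit_iff.mp hu with h | h <;> omega
  exact ⟨⟨S, h1⟩, hm⟩

section Multiplicity

open Topology Filter

/-- `SL₂(ℤ)` acts properly discontinuously: near a point, only finitely many elements move points
close to it to points close to it. -/
theorem exists_nhds_finite_moeb {z₀ : ℂ} (hz : 0 < z₀.im) :
    ∃ U ∈ 𝓝 z₀, (∀ z ∈ U, 0 < z.im) ∧ {M : SL2Z | ∃ z ∈ U, moeb M z ∈ U}.Finite := by
  obtain ⟨K, hK, hKn⟩ := exists_compact_mem_nhds (⟨z₀, hz⟩ : UpperHalfPlane)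
  have hfin := ((Subgroup.properlyDiscontinuousSMul_iff _).mp properlyDiscontinuousSL2ZRange hK
    hK).preimage (Matrix.SpecialLinearGroup.mapGL_injective (R := ℤ) (S := ℝ)
      (n := Fin 2)).injOn
  refine ⟨(↑) '' K, UpperHalfPlane.isOpenEmbedding_coe.image_mem_nhds.mpr hKn, ?_,
    hfin.subset ?_⟩
  · rintro _ ⟨z, -, rfl⟩
    exact z.im_pos
  · rintro M ⟨_, ⟨z, hzK, rfl⟩, ⟨w, hwK, hw⟩⟩
    refine ⟨⟨M, rfl⟩, w, ⟨z, hzK, ?_⟩, hwK⟩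
    apply UpperHalfPlane.ext
    exact (coe_smul_eq_moeb M z).trans hw.symm

theorem continuousAt_moeb (M : Mat) {z : ℂ} (h : (M 1 0 : ℂ) * z + M 1 1 ≠ 0) :
    ContinuousAt (moeb M) z := by
  unfold moeb
  exact ContinuousAt.div (by fun_prop) (by fun_prop) h

theorem denom_ne_zero_of_det {S : Mat} (hS : S.det ≠ 0) {z : ℂ} (hz : 0 < z.im) :
    (S 1 0 : ℂ) * z + S 1 1 ≠ 0 := by
  intro h
  obtain ⟨h1, h2⟩ := int_mul_add_eq_zero hz h
  rw [Matrix.det_fin_two, h1, h2] at hS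
  simp at hS

theorem SL2Z_det_ne_zero (M : SL2Z) : (M : Mat).det ≠ 0 := by
  rw [M.2]; exact one_ne_zero

theorem finite_stabilizer_moeb {z₀ : ℂ} (hz : 0 < z₀.im) :
    {M : SL2Z | moeb M z₀ = z₀}.Finite := by
  obtain ⟨U, hU, -, hfin⟩ := exists_nhds_finite_moeb hz
  refine hfin.subset fun M hM => ⟨z₀, mem_of_mem_nhds hU, ?_⟩
  rw [Set.mem_ofPred_eq] at hM
  rw [hM]
  exact mem_of_mem_nhds hU

theorem eventually_moeb_eq_imp_stabilizer {z₀ : ℂ} (hz : 0 < z₀.im) :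
    ∃ U ∈ 𝓝 z₀, (∀ z ∈ U, 0 < z.im) ∧ ∀ z ∈ U, ∀ M : SL2Z, moeb M z ∈ U → moeb M z₀ = z₀ := by
  obtain ⟨U, hU, hU', hfin⟩ := exists_nhds_finite_moeb hz
  have h : ∀ M ∈ {M : SL2Z | ∃ z ∈ U, moeb M z ∈ U}, ∀ᶠ p in 𝓝 z₀ ×ˢ 𝓝 z₀,
      moeb M p.1 = p.2 → moeb M z₀ = z₀ := by
    intro M _
    by_cases hM : moeb M z₀ = z₀
    · simp [hM]
    have hc : Tendsto (fun p : ℂ × ℂ => moeb M p.1 - p.2) (𝓝 z₀ ×ˢ 𝓝 z₀)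
        (𝓝 (moeb M z₀ - z₀)) :=
      ((continuousAt_moeb M (denom_ne_zero_of_det (SL2Z_det_ne_zero M) hz)).tendsto.comp
        tendsto_fst).sub tendsto_snd
    filter_upwards [hc.eventually_ne (sub_ne_zero.mpr hM)] with p hp hp'
    exact absurd (sub_eq_zero.mpr hp') hp
  obtain ⟨V, hV, hV'⟩ := Filter.mem_prod_self_iff.mp
    ((Filter.eventually_all_finite hfin).mpr h)
  refine ⟨U ∩ V, inter_mem hU hV, fun z hz => hU' z hz.1, fun z hz M hM => ?_⟩
  exact hV' (Set.mk_mem_prod hz.2 hM.2) M ⟨z, hz.1, hM.1⟩ rfl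

theorem moeb_mul (S T : Mat) {z : ℂ} (h : (T 1 0 : ℂ) * z + T 1 1 ≠ 0) :
    moeb (S * T) z = moeb S (moeb T z) := by
  simp only [moeb, Matrix.mul_apply, Fin.sum_univ_two]
  push_cast
  have key (p q n d : ℂ) (hd : d ≠ 0) : p * (n / d) + q = (p * n + q * d) / d := by
    field_simp
  rw [key _ _ _ _ h, key _ _ _ _ h, div_div_div_cancel_right₀ h]
  congr 1 <;> ring

theorem moeb_one (z : ℂ) : moeb 1 z = z := by simp [moeb]

theorem moeb_injOn (M : SL2Z) {z w : ℂ} (hz : 0 < z.im) (hw : 0 < w.im)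
    (h : moeb M z = moeb M w) : z = w := by
  have key : ∀ {z : ℂ}, 0 < z.im → moeb (M⁻¹ : SL2Z) (moeb M z) = z := by
    intro z hz
    rw [← moeb_mul _ _ (denom_ne_zero_of_det (SL2Z_det_ne_zero M) hz)]
    have : ((M⁻¹ : SL2Z) : Mat) * M = 1 := by
      rw [← Matrix.SpecialLinearGroup.coe_mul, inv_mul_cancel, Matrix.SpecialLinearGroup.coe_one]
    rw [this, moeb_one]
  rw [← key hz, h, key hw]

theorem moeb_im_pos {S : Mat} (hS : 0 < S.det) {z : ℂ} (hz : 0 < z.im) : 0 < (moeb S z).im := by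
  rw [moeb_im]
  have := normSq_pos.mpr (denom_ne_zero_of_det hS.ne' hz)
  have : (0 : ℝ) < S.det := by exact_mod_cast hS
  positivity

theorem hasStrictDerivAt_moeb {S : Mat} (hS : S.det ≠ 0) {z : ℂ} (hz : 0 < z.im) :
    HasStrictDerivAt (moeb S) (S.det / (S 1 0 * z + S 1 1) ^ 2) z := by
  have hd := denom_ne_zero_of_det hS hz
  have h1 : HasStrictDerivAt (fun z : ℂ => (S 0 0 : ℂ) * z + S 0 1) (S 0 0) z := by
    simpa using ((hasStrictDerivAt_id z).const_mul (S 0 0 : ℂ)).add_const (S 0 1 : ℂ)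
  have h2 : HasStrictDerivAt (fun z : ℂ => (S 1 0 : ℂ) * z + S 1 1) (S 1 0) z := by
    simpa using ((hasStrictDerivAt_id z).const_mul (S 1 0 : ℂ)).add_const (S 1 1 : ℂ)
  refine (h1.fun_div h2 hd).congr_deriv ?_
  rw [Matrix.det_fin_two]
  push_cast
  congr 1
  ring

theorem analyticAt_moeb {S : Mat} (hS : S.det ≠ 0) {z : ℂ} (hz : 0 < z.im) :
    AnalyticAt ℂ (moeb S) z := by
  have hd := denom_ne_zero_of_det hS hz
  unfold moeb
  exact AnalyticAt.div (by fun_prop) (by fun_prop) hd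

theorem eventually_im_pos {z₀ : ℂ} (hz : 0 < z₀.im) : ∀ᶠ z in 𝓝 z₀, 0 < z.im :=
  (isOpen_lt continuous_const continuous_im).mem_nhds hz

theorem analyticOrderAt_jC_ne_top {z₀ : ℂ} (hz : 0 < z₀.im) :
    analyticOrderAt (fun z => jC z - jC z₀) z₀ ≠ ⊤ := by
  rw [Ne, analyticOrderAt_eq_top]
  intro h
  obtain ⟨U, hU, hU', hst⟩ := eventually_moeb_eq_imp_stabilizer hz
  have : ∀ᶠ z in 𝓝 z₀, z = z₀ := by
    filter_upwards [h, hU] with z hj hzU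
    obtain ⟨M, hM⟩ := exists_moeb_eq_of_jC_eq (hU' z hzU) hz (sub_eq_zero.mp hj)
    have hM' := hst z hzU M (by rw [hM]; exact mem_of_mem_nhds hU)
    exact moeb_injOn M (hU' z hzU) hz (hM.trans hM'.symm)
  have h2 : ∀ᶠ z in 𝓝[≠] z₀, False := by
    filter_upwards [nhdsWithin_le_nhds this, self_mem_nhdsWithin] with z h1 h2
    exact h2 h1
  exact h2.exists.choose_spec

/-- A nonvanishing analytic germ has an analytic `e`-th root. -/
theorem AnalyticAt.exists_pow_eq {g : ℂ → ℂ} {z₀ : ℂ} (hg : AnalyticAt ℂ g z₀) (h0 : g z₀ ≠ 0)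
    {e : ℕ} (he : e ≠ 0) :
    ∃ r : ℂ → ℂ, AnalyticAt ℂ r z₀ ∧ r z₀ ≠ 0 ∧ ∀ z, r z ^ e = g z := by
  obtain ⟨c, hc⟩ := IsAlgClosed.exists_pow_nat_eq (g z₀) (n := e) (Nat.pos_of_ne_zero he)
  have hc0 : c ≠ 0 := by
    rintro rfl
    rw [zero_pow he] at hc
    exact h0 hc.symm
  refine ⟨fun z => c * (g z / g z₀) ^ ((e : ℂ)⁻¹), ?_, ?_, fun z => ?_⟩
  · refine analyticAt_const.mul (AnalyticAt.cpow (hg.div analyticAt_const h0) analyticAt_const ?_)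
    simp [h0]
  · simp [h0, hc0]
  · rw [mul_pow, cpow_nat_inv_pow _ he, hc]
    field_simp

/-- If `T` fixes `z₀` with multiplier a root of unity of order dividing the ramification index of
`j` at `z₀`, then an element of the stabiliser of `z₀` in `SL₂(ℤ)` has the same multiplier. -/
theorem exists_stabilizer_deriv_eq {z₀ : ℂ} (hz : 0 < z₀.im) {e : ℕ}
    (he : analyticOrderAt (fun z => jC z - jC z₀) z₀ = e) {ζ : ℂ} (hζ : ζ ^ e = 1) :
    ∃ M : SL2Z, moeb M z₀ = z₀ ∧ ζ = 1 / ((M 1 0 : ℂ) * z₀ + M 1 1) ^ 2 := by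
  have hja : AnalyticAt ℂ (fun z => jC z - jC z₀) z₀ := (analyticAt_jC hz).sub analyticAt_const
  have he0 : e ≠ 0 := by
    rintro rfl
    exact hja.analyticOrderAt_ne_zero.mpr (sub_self _) (by simpa using he)
  obtain ⟨g, hg, hg0, hjg⟩ := hja.analyticOrderAt_eq_natCast.mp he
  obtain ⟨r, hr, hr0, hrg⟩ := AnalyticAt.exists_pow_eq hg hg0 he0
  set h : ℂ → ℂ := fun z => (z - z₀) * r z with hh
  have hha : AnalyticAt ℂ h z₀ := (analyticAt_id.sub analyticAt_const).mul hr
  have hhd : HasStrictDerivAt h (r z₀) z₀ := by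
    have h1 : HasStrictDerivAt (fun z : ℂ => z - z₀) 1 z₀ :=
      (hasStrictDerivAt_id z₀).sub_const z₀
    simpa using h1.fun_mul hr.hasStrictDerivAt
  have hh0 : h z₀ = 0 := by simp [hh]
  have hje : ∀ᶠ z in 𝓝 z₀, jC z - jC z₀ = h z ^ e := by
    filter_upwards [hjg] with z hz
    rw [hz, hh, mul_pow, hrg, smul_eq_mul]
  obtain ⟨U, hU, hU', hst⟩ := eventually_moeb_eq_imp_stabilizer hz
  have hmap := hhd.map_nhds_eq hr0
  have himg : h '' (U ∩ {z | jC z - jC z₀ = h z ^ e}) ∈ 𝓝 (0 : ℂ) := by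
    rw [← hh0, ← hmap]
    exact image_mem_map (inter_mem hU hje)
  have hcont : Tendsto (fun z => ζ * h z) (𝓝 z₀) (𝓝 0) := by
    have := (hha.continuousAt.tendsto).const_mul ζ
    rwa [hh0, mul_zero] at this
  have hex : ∀ᶠ z in 𝓝 z₀, ∃ M ∈ {M : SL2Z | moeb M z₀ = z₀}, h (moeb M z) = ζ * h z := by
    filter_upwards [hcont himg, hje, hU] with z ⟨y, ⟨hyU, hyj⟩, hyz⟩ hzj hzU
    have hjj : jC z = jC y := by
      have : jC y - jC z₀ = jC z - jC z₀ := by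
        rw [Set.mem_ofPred_eq] at hyj
        rw [hyj, hyz, hzj, mul_pow, hζ, one_mul]
      exact (sub_left_injective this).symm
    obtain ⟨M, hM⟩ := exists_moeb_eq_of_jC_eq (hU' z hzU) (hU' y hyU) hjj
    exact ⟨M, hst z hzU M (by rwa [hM]), by rw [hM, hyz]⟩
  obtain ⟨M, hM, hfr⟩ : ∃ M ∈ {M : SL2Z | moeb M z₀ = z₀},
      ∃ᶠ z in 𝓝[≠] z₀, h (moeb M z) = ζ * h z := by
    by_contra! hcon
    have hall := (Filter.eventually_all_finite (finite_stabilizer_moeb hz)).mpr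
      (fun M hM => hcon M hM)
    have : ∀ᶠ z in 𝓝[≠] z₀, False := by
      filter_upwards [hall, nhdsWithin_le_nhds hex] with z h1 ⟨M, hM, h2⟩
      exact h1 M hM h2
    exact this.exists.choose_spec
  refine ⟨M, hM, ?_⟩
  have hM' : moeb M z₀ = z₀ := hM
  have hca : AnalyticAt ℂ (h ∘ moeb M) z₀ :=
    AnalyticAt.comp (by rwa [hM']) (analyticAt_moeb (SL2Z_det_ne_zero M) hz)
  have heq := (hca.frequently_eq_iff_eventually_eq (analyticAt_const.mul hha)).mp hfr
  have hd1 : HasDerivAt (h ∘ moeb M) _ z₀ := HasDerivAt.comp z₀ (by rw [hM']; exact hhd.hasDerivAt)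
    (hasStrictDerivAt_moeb (SL2Z_det_ne_zero M) hz).hasDerivAt
  have hd2 := hhd.hasDerivAt.const_mul ζ
  have := hd1.unique (hd2.congr_of_eventuallyEq heq)
  rw [mul_comm] at this
  have := mul_right_cancel₀ hr0 this
  rw [← this, M.2]
  simp

theorem Mat.isPrimitive_iff (S : Mat) :
    S.IsPrimitive ↔ ∀ t : ℤ, 1 < t → ¬ ∀ i j, t ∣ S i j := by
  rw [Mat.IsPrimitive]
  constructor
  · intro h t ht hdiv
    have h1 : t.natAbs ∣ 1 := by
      rw [← h]
      exact Nat.dvd_gcd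
        (Nat.dvd_gcd (Int.natAbs_dvd_natAbs.mpr (hdiv 0 0)) (Int.natAbs_dvd_natAbs.mpr (hdiv 0 1)))
        (Nat.dvd_gcd (Int.natAbs_dvd_natAbs.mpr (hdiv 1 0)) (Int.natAbs_dvd_natAbs.mpr (hdiv 1 1)))
    have := Nat.dvd_one.mp h1
    omega
  · intro h
    by_contra hne
    set g := Nat.gcd (Nat.gcd (S 0 0).natAbs (S 0 1).natAbs)
      (Nat.gcd (S 1 0).natAbs (S 1 1).natAbs) with hg
    have hl := Nat.gcd_dvd_left (Nat.gcd (S 0 0).natAbs (S 0 1).natAbs)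
      (Nat.gcd (S 1 0).natAbs (S 1 1).natAbs)
    have hr := Nat.gcd_dvd_right (Nat.gcd (S 0 0).natAbs (S 0 1).natAbs)
      (Nat.gcd (S 1 0).natAbs (S 1 1).natAbs)
    rw [← hg] at hl hr
    have hall : ∀ i j, (g : ℤ) ∣ S i j := by
      intro i j
      rw [Int.natCast_dvd]
      fin_cases i <;> fin_cases j
      · exact hl.trans (Nat.gcd_dvd_left _ _)
      · exact hl.trans (Nat.gcd_dvd_right _ _)
      · exact hr.trans (Nat.gcd_dvd_left _ _)
      · exact hr.trans (Nat.gcd_dvd_right _ _)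
    rcases Nat.lt_or_ge 1 g with h1 | h1
    · exact h g (by exact_mod_cast h1) hall
    · have hg0 : g = 0 := by omega
      rw [hg0] at hall
      exact h 2 (by norm_num) fun i j => by
        have := hall i j
        simp only [Nat.cast_zero, zero_dvd_iff] at this
        simp [this]

theorem moeb_eq_self_iff {S : Mat} {z : ℂ} (h : (S 1 0 : ℂ) * z + S 1 1 ≠ 0) :
    moeb S z = z ↔ (S 0 0 : ℂ) * z + S 0 1 = ((S 1 0 : ℂ) * z + S 1 1) * z := by
  rw [moeb, div_eq_iff h, mul_comm z]

/-- A primitive matrix of determinant `s > 1` fixing `z₀` does not have the same multiplier at `z₀`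
as an element of `SL₂(ℤ)` fixing `z₀`. -/
theorem multiplier_ne_of_isPrimitive {z₀ : ℂ} (hz : 0 < z₀.im) {T : Mat} (hT : T.IsPrimitive)
    {s : ℤ} (hs : 1 < s) (hdet : T.det = s) (hfix : moeb T z₀ = z₀) {M : SL2Z}
    (hM : moeb M z₀ = z₀) :
    (s : ℂ) / ((T 1 0 : ℂ) * z₀ + T 1 1) ^ 2 ≠ 1 / ((M 1 0 : ℂ) * z₀ + M 1 1) ^ 2 := by
  intro h
  have hT0 := denom_ne_zero_of_det (S := T) (by omega) hz
  have hM0 := denom_ne_zero_of_det (SL2Z_det_ne_zero M) hz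
  have hM0' : (M 1 0 : ℂ) * z₀ + M 1 1 ≠ 0 := hM0
  rw [moeb_eq_self_iff hT0] at hfix
  rw [moeb_eq_self_iff hM0] at hM
  obtain ⟨N, hN⟩ : ∃ N : Mat, N = ((M⁻¹ : SL2Z) : Mat) := ⟨_, rfl⟩
  have hNM : N * (M : Mat) = 1 := by
    rw [hN, ← Matrix.SpecialLinearGroup.coe_mul, inv_mul_cancel, Matrix.SpecialLinearGroup.coe_one]
  obtain ⟨A, hA⟩ : ∃ A : Mat, A = T * N := ⟨_, rfl⟩
  have hAM : A * (M : Mat) = T := by rw [hA, mul_assoc, hNM, mul_one]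
  have hAdet : A.det = s := by
    have := congrArg Matrix.det hAM
    rwa [Matrix.det_mul, M.2, mul_one, hdet] at this
  set m : ℂ := (M 1 0 : ℂ) * z₀ + M 1 1 with hm
  set n : ℂ := (T 1 0 : ℂ) * z₀ + T 1 1 with hn
  have hT1 : (T 1 0 : ℂ) = A 1 0 * M 0 0 + A 1 1 * M 1 0 := by
    rw [← hAM, Matrix.mul_apply, Fin.sum_univ_two]; push_cast; rfl
  have hT2 : (T 1 1 : ℂ) = A 1 0 * M 0 1 + A 1 1 * M 1 1 := by
    rw [← hAM, Matrix.mul_apply, Fin.sum_univ_two]; push_cast; rfl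
  have hT3 : (T 0 0 : ℂ) = A 0 0 * M 0 0 + A 0 1 * M 1 0 := by
    rw [← hAM, Matrix.mul_apply, Fin.sum_univ_two]; push_cast; rfl
  have hT4 : (T 0 1 : ℂ) = A 0 0 * M 0 1 + A 0 1 * M 1 1 := by
    rw [← hAM, Matrix.mul_apply, Fin.sum_univ_two]; push_cast; rfl
  have hM' : (M 0 0 : ℂ) * z₀ + M 0 1 = m * z₀ := hM
  have h1 : n = (A 1 0 * z₀ + A 1 1) * m := by
    rw [hn, hT1, hT2]
    linear_combination (A 1 0 : ℂ) * hM'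
  have h2 : ((A 0 0 : ℂ) * z₀ + A 0 1) = (A 1 0 * z₀ + A 1 1) * z₀ := by
    apply mul_right_cancel₀ hM0'
    rw [hT3, hT4] at hfix
    linear_combination hfix - (A 0 0 : ℂ) * hM' + z₀ * h1
  have h3 : ((A 1 0 : ℂ) * z₀ + A 1 1) ^ 2 = s := by
    rw [div_eq_div_iff (pow_ne_zero 2 hT0) (pow_ne_zero 2 hM0')] at h
    apply mul_right_cancel₀ (pow_ne_zero 2 hM0')
    rw [h1] at h
    linear_combination -h
  have him : ((A 1 0 : ℂ) * z₀ + A 1 1).im = 0 := by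
    set w := (A 1 0 : ℂ) * z₀ + A 1 1 with hw
    have e1 := congrArg im h3
    have e2 := congrArg re h3
    rw [sq] at e1 e2
    simp only [mul_im, mul_re, intCast_im, intCast_re] at e1 e2
    by_contra hne
    have : w.re = 0 := by
      have : w.re * w.im = 0 := by linarith
      exact (mul_eq_zero.mp this).resolve_right hne
    rw [this] at e2
    have hs' : (0 : ℝ) < s := by exact_mod_cast (by omega : 0 < s)
    nlinarith [sq_nonneg w.im]
  have hA10 : A 1 0 = 0 := by simpa [hz.ne'] using him
  rw [hA10] at h2 h3
  have h4 := int_mul_add_eq_zero hz (p := A 0 0 - A 1 1) (q := A 0 1)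
    (by push_cast at h2 ⊢; linear_combination h2)
  have h5 : (A 1 1) ^ 2 = s := by
    simp only [Int.cast_zero, zero_mul, zero_add] at h3
    exact_mod_cast h3
  have hTA : ∀ i j, T i j = A 1 1 * M i j := by
    intro i j
    rw [← hAM, Matrix.mul_apply, Fin.sum_univ_two]
    fin_cases i
    · simp [h4.2, show A 0 0 = A 1 1 by linarith [h4.1]]
    · simp [hA10]
  refine (Mat.isPrimitive_iff T).mp hT |A 1 1| ?_ fun i j => ?_
  · by_contra! hle
    have : (A 1 1) ^ 2 ≤ 1 := by rw [← sq_abs]; nlinarith [abs_nonneg (A 1 1)]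
    omega
  · rw [abs_dvd, hTA]
    exact dvd_mul_right _ _

theorem moeb_sub_moeb (S : Mat) {z w : ℂ} (hz : (S 1 0 : ℂ) * z + S 1 1 ≠ 0)
    (hw : (S 1 0 : ℂ) * w + S 1 1 ≠ 0) :
    moeb S z - moeb S w =
      (z - w) * (S.det / ((S 1 0 * z + S 1 1) * (S 1 0 * w + S 1 1))) := by
  rw [moeb, moeb, div_sub_div _ _ hz hw, ← mul_div_assoc, Matrix.det_fin_two]
  push_cast
  congr 1
  ring

/-- For a primitive matrix `T` of determinant `s > 1` fixing `z₀`, the difference `j - j ∘ T`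
vanishes at `z₀` to the same order as `j - j(z₀)`. -/
theorem analyticOrderAt_jC_sub_jC_moeb {z₀ : ℂ} (hz : 0 < z₀.im) {T : Mat} (hT : T.IsPrimitive)
    {s : ℤ} (hs : 1 < s) (hdet : T.det = s) (hfix : moeb T z₀ = z₀) :
    analyticOrderAt (fun z => jC z - jC (moeb T z)) z₀ =
      analyticOrderAt (fun z => jC z - jC z₀) z₀ := by
  have hja : AnalyticAt ℂ (fun z => jC z - jC z₀) z₀ := (analyticAt_jC hz).sub analyticAt_const
  obtain ⟨e, he⟩ := ENat.ne_top_iff_exists.mp (analyticOrderAt_jC_ne_top hz)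
  have hT0 : T.det ≠ 0 := by omega
  have hTa := analyticAt_moeb hT0 hz
  have hd0 := denom_ne_zero_of_det hT0 hz
  obtain ⟨g, hg, hg0, hjg⟩ := hja.analyticOrderAt_eq_natCast.mp he.symm
  have hjT : AnalyticAt ℂ (fun z => jC (moeb T z)) z₀ :=
    AnalyticAt.comp (g := jC) (by rw [hfix]; exact analyticAt_jC hz) hTa
  rw [← he, AnalyticAt.analyticOrderAt_eq_natCast ((analyticAt_jC hz).fun_sub hjT)]
  set q : ℂ → ℂ := fun z => T.det / ((T 1 0 * z + T 1 1) * (T 1 0 * z₀ + T 1 1)) with hq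
  have hqa : AnalyticAt ℂ q z₀ :=
    AnalyticAt.div (by fun_prop) (by fun_prop) (mul_ne_zero hd0 hd0)
  have hgT : AnalyticAt ℂ (fun z => g (moeb T z)) z₀ :=
    AnalyticAt.comp (g := g) (by rwa [hfix]) hTa
  refine ⟨fun z => g z - q z ^ e * g (moeb T z), hg.fun_sub ((hqa.fun_pow e).fun_mul hgT), ?_, ?_⟩
  · simp only [hfix]
    rw [← one_sub_mul]
    refine mul_ne_zero (sub_ne_zero.mpr fun h1 => ?_) hg0
    obtain ⟨M, hM, hζ⟩ := exists_stabilizer_deriv_eq hz he.symm h1.symm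
    refine multiplier_ne_of_isPrimitive hz hT hs hdet hfix hM ?_
    rw [← hζ, hq, hdet, sq]
  · have hT' : Tendsto (moeb T) (𝓝 z₀) (𝓝 z₀) := by
      have := hTa.continuousAt.tendsto
      rwa [hfix] at this
    filter_upwards [hjg, hT'.eventually hjg, eventually_im_pos hz] with z h1 h2 hzim
    have h3 : moeb T z - z₀ = (z - z₀) * q z := by
      have h4 := moeb_sub_moeb T (denom_ne_zero_of_det hT0 hzim) hd0
      rwa [hfix] at h4
    rw [h3, mul_pow] at h2
    simp only [smul_eq_mul] at h1 h2 ⊢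
    linear_combination h1 - h2

theorem dvd_mul_entries {S : Mat} {t : ℤ} (h : ∀ i j, t ∣ S i j) (A : Mat) (i j : Fin 2) :
    t ∣ (A * S) i j := by
  rw [Matrix.mul_apply]
  exact Finset.dvd_sum fun k _ => (h k j).mul_left _

theorem inv_mul_mul_SL2Z (M : SL2Z) (S : Mat) : ((M⁻¹ : SL2Z) : Mat) * ((M : Mat) * S) = S := by
  rw [← mul_assoc, ← Matrix.SpecialLinearGroup.coe_mul, inv_mul_cancel,
    Matrix.SpecialLinearGroup.coe_one, one_mul]

theorem Mat.IsPrimitive.SL2Z_mul {S : Mat} (hS : S.IsPrimitive) (M : SL2Z) :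
    Mat.IsPrimitive ((M : Mat) * S) := by
  rw [Mat.isPrimitive_iff] at hS ⊢
  intro t ht h
  refine hS t ht fun i j => ?_
  rw [← inv_mul_mul_SL2Z M S]
  exact dvd_mul_entries h _ i j

theorem det_SL2Z_mul (M : SL2Z) (S : Mat) : ((M : Mat) * S).det = S.det := by
  rw [Matrix.det_mul, M.2, one_mul]

theorem analyticOrderAt_prod {ι : Type*} (t : Finset ι) (f : ι → ℂ → ℂ) {z₀ : ℂ}
    (hf : ∀ i ∈ t, AnalyticAt ℂ (f i) z₀) :
    analyticOrderAt (fun z => ∏ i ∈ t, f i z) z₀ = ∑ i ∈ t, analyticOrderAt (f i) z₀ := by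
  classical
  induction t using Finset.induction_on with
  | empty =>
    simp only [Finset.prod_empty, Finset.sum_empty]
    exact analyticAt_const.analyticOrderAt_eq_zero.mpr one_ne_zero
  | insert a t ha ih =>
    simp only [Finset.prod_insert ha, Finset.sum_insert ha]
    rw [← ih fun i hi => hf i (Finset.mem_insert_of_mem hi)]
    exact analyticOrderAt_mul (hf a (Finset.mem_insert_self a t))
      (Finset.analyticAt_fun_prod _ fun i hi => hf i (Finset.mem_insert_of_mem hi))

theorem diagPoly_eval_jC {s : ℕ} {J : Polynomial (Polynomial ℤ)} (hJ : IsModularPoly s J)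
    {R : Fin (psi s) → Mat} (hR : IsOrbitReps s R) {z : ℂ} (hz : 0 < z.im) :
    ((diagPoly J).map (Int.castRingHom ℂ)).eval (jC z) =
      ∏ ν, (jC z - jC (moeb (R ν) z)) := by
  have h1 : evalAtJ z X = jC z := by simp [evalAtJ]
  have h2 := congrArg (Polynomial.eval (jC z)) (hJ.2.2 R hR z hz)
  rw [eval_prod] at h2
  simp only [eval_sub, eval_X, eval_C] at h2
  rw [← h2]
  have h3 : (J.map (evalAtJ z)).eval (evalAtJ z X) = evalAtJ z (J.eval X) := by
    rw [eval_map, eval₂_at_apply]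
  rw [h1] at h3
  rw [h3, eval_map]
  rfl

theorem analyticOrderAt_jC_sub_of_isPrimitive {z₀ : ℂ} (hz : 0 < z₀.im) {S : Mat}
    (hS : S.IsPrimitive) {s : ℤ} (hs : 1 < s) (hdet : S.det = s) :
    analyticOrderAt (fun z => jC z - jC (moeb S z)) z₀ =
      if jC (moeb S z₀) = jC z₀ then analyticOrderAt (fun z => jC z - jC z₀) z₀ else 0 := by
  have hpos : 0 < S.det := by omega
  have him := moeb_im_pos hpos hz
  split_ifs with h
  · obtain ⟨M, hM⟩ := exists_moeb_eq_of_jC_eq him hz h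
    have hfix : moeb ((M : Mat) * S) z₀ = z₀ := by
      rw [moeb_mul _ _ (denom_ne_zero_of_det hpos.ne' hz), hM]
    rw [← analyticOrderAt_jC_sub_jC_moeb hz (hS.SL2Z_mul M) hs
      ((det_SL2Z_mul M S).trans hdet) hfix]
    apply analyticOrderAt_congr
    filter_upwards [eventually_im_pos hz] with z hzim
    rw [moeb_mul _ _ (denom_ne_zero_of_det hpos.ne' hzim), jC_moeb M (moeb_im_pos hpos hzim)]
  · have hja : AnalyticAt ℂ (fun z => jC (moeb S z)) z₀ :=
      AnalyticAt.comp (g := jC) (analyticAt_jC him) (analyticAt_moeb hpos.ne' hz)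
    exact ((analyticAt_jC hz).fun_sub hja).analyticOrderAt_eq_zero.mpr
      (sub_ne_zero.mpr (Ne.symm h))

theorem rootMultiplicity_diagPoly {s : ℕ} (hs : 1 < s) {J : Polynomial (Polynomial ℤ)}
    (hJ : IsModularPoly s J) {R : Fin (psi s) → Mat} (hR : IsOrbitReps s R) {z₀ : ℂ}
    (hz : 0 < z₀.im) :
    ((diagPoly J).map (Int.castRingHom ℂ)).rootMultiplicity (jC z₀) =
      Nat.card {ν // jC (moeb (R ν) z₀) = jC z₀} := by
  classical
  set P := (diagPoly J).map (Int.castRingHom ℂ) with hP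
  have hja : AnalyticAt ℂ (fun z => jC z - jC z₀) z₀ := (analyticAt_jC hz).fun_sub analyticAt_const
  obtain ⟨e, he⟩ := ENat.ne_top_iff_exists.mp (analyticOrderAt_jC_ne_top hz)
  have he0 : e ≠ 0 := by
    rintro rfl
    exact hja.analyticOrderAt_ne_zero.mpr (sub_self _) (by simpa using he.symm)
  have hord : analyticOrderAt (fun z => P.eval (jC z)) z₀ =
      ((Nat.card {ν // jC (moeb (R ν) z₀) = jC z₀} * e : ℕ) : ℕ∞) := by
    rw [analyticOrderAt_congr (g := fun z => ∏ ν, (jC z - jC (moeb (R ν) z)))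
      (by filter_upwards [eventually_im_pos hz] with z h using diagPoly_eval_jC hJ hR h),
      analyticOrderAt_prod]
    · have : ∀ ν, analyticOrderAt (fun z => jC z - jC (moeb (R ν) z)) z₀ =
          ((if jC (moeb (R ν) z₀) = jC z₀ then e else 0 : ℕ) : ℕ∞) := by
        intro ν
        rw [analyticOrderAt_jC_sub_of_isPrimitive hz (hR.1 ν).1 (by exact_mod_cast hs)
          (hR.1 ν).2, ← he]
        split_ifs <;> simp
      rw [Finset.sum_congr rfl fun ν _ => this ν, ← Nat.cast_sum]
      congr 1
      rw [← Finset.sum_filter, Finset.sum_const, smul_eq_mul, Nat.card_eq_fintype_card,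
        Fintype.card_subtype]
    · intro ν _
      have hpos : 0 < (R ν).det := by rw [(hR.1 ν).2]; omega
      exact (analyticAt_jC hz).fun_sub (AnalyticAt.comp (g := jC)
        (analyticAt_jC (moeb_im_pos hpos hz)) (analyticAt_moeb hpos.ne' hz))
  have hP0 : P ≠ 0 := by
    intro h0
    rw [analyticOrderAt_eq_top.mpr (by simp [h0])] at hord
    exact ENat.natCast_ne_top _ hord.symm
  obtain ⟨Q, hQ, hQ0⟩ := exists_eq_pow_rootMultiplicity_mul_and_not_dvd P hP0 (jC z₀)
  set m := P.rootMultiplicity (jC z₀) with hm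
  have hQa : AnalyticAt ℂ (fun z => Q.eval (jC z)) z₀ := by
    have : AnalyticAt ℂ (fun w => Q.eval w) (jC z₀) := by
      exact Polynomial.differentiable Q |>.analyticAt _
    exact AnalyticAt.comp (g := fun w => Q.eval w) this (analyticAt_jC hz)
  have hfun : (fun z => P.eval (jC z)) =
      (fun z => jC z - jC z₀) ^ m * (fun z => Q.eval (jC z)) := by
    funext z
    conv_lhs => rw [hQ]
    simp
  rw [hfun, analyticOrderAt_mul (hja.pow m) hQa, analyticOrderAt_pow hja, ← he,
    hQa.analyticOrderAt_eq_zero.mpr (by rwa [dvd_iff_isRoot] at hQ0), add_zero, nsmul_eq_mul]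
    at hord
  norm_cast at hord
  exact Nat.eq_of_mul_eq_mul_right (Nat.pos_of_ne_zero he0) hord

end Multiplicity

/-- The upper triangular matrix encoded by a triple `(a, b, d)`. -/
def triMat (t : ℕ × ℕ × ℕ) : Mat := !![(t.1 : ℤ), (t.2.1 : ℤ); 0, (t.2.2 : ℤ)]

theorem exists_SL2Z_mul_triMat {s : ℕ} (hs : 0 < s) {T : Mat} (hT : T.det = s) :
    ∃ t : ℕ × ℕ × ℕ, 0 < t.1 ∧ 0 < t.2.2 ∧ t.1 * t.2.2 = s ∧ t.2.1 < t.2.2 ∧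
      ∃ M : SL2Z, T = (M : Mat) * triMat t := by
  have hm : (s : ℤ) ≠ 0 := by omega
  refine FixedDetMatrices.induction_on (m := s) (A := ⟨T, hT⟩)
    (C := fun A => ∃ t : ℕ × ℕ × ℕ, 0 < t.1 ∧ 0 < t.2.2 ∧ t.1 * t.2.2 = s ∧ t.2.1 < t.2.2 ∧
      ∃ M : SL2Z, A.1 = (M : Mat) * triMat t) hm ?_ ?_ ?_
  · rintro ⟨A, hA⟩ hc ha hb hbd
    simp only at hc ha hb hbd
    rw [Matrix.det_fin_two, hc, mul_zero, sub_zero] at hA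
    have hd : 0 < A 1 1 := by
      have : 0 < A 0 0 * A 1 1 := by omega
      exact pos_of_mul_pos_right this ha.le
    rw [abs_of_nonneg hb, abs_of_pos hd] at hbd
    refine ⟨((A 0 0).toNat, (A 0 1).toNat, (A 1 1).toNat), by simpa using ha, by simpa using hd,
      ?_, ?_, 1, ?_⟩
    · zify
      rw [Int.toNat_of_nonneg ha.le, Int.toNat_of_nonneg hd.le, hA]
    · zify
      rwa [Int.toNat_of_nonneg hb, Int.toNat_of_nonneg hd.le]
    · rw [Matrix.SpecialLinearGroup.coe_one, one_mul]
      ext i j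
      fin_cases i <;> fin_cases j <;> simp [triMat, ha.le, hb, hc, hd.le]
  · rintro B ⟨t, h1, h2, h3, h4, M, hM⟩
    refine ⟨t, h1, h2, h3, h4, ModularGroup.S * M, ?_⟩
    rw [FixedDetMatrices.smul_coe, hM, Matrix.SpecialLinearGroup.coe_mul, mul_assoc]
  · rintro B ⟨t, h1, h2, h3, h4, M, hM⟩
    refine ⟨t, h1, h2, h3, h4, ModularGroup.T * M, ?_⟩
    rw [FixedDetMatrices.smul_coe, hM, Matrix.SpecialLinearGroup.coe_mul, mul_assoc]

theorem triMat_unique {t t' : ℕ × ℕ × ℕ} (ha : 0 < t.1) (ha' : 0 < t'.1) (hb : t.2.1 < t.2.2)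
    (hb' : t'.2.1 < t'.2.2) {M : SL2Z} (h : triMat t' = (M : Mat) * triMat t) : t = t' := by
  obtain ⟨a, b, d⟩ := t
  obtain ⟨a', b', d'⟩ := t'
  have hdet := M.2
  rw [Matrix.det_fin_two] at hdet
  have h00 := congrFun (congrFun h 0) 0
  have h01 := congrFun (congrFun h 0) 1
  have h10 := congrFun (congrFun h 1) 0
  have h11 := congrFun (congrFun h 1) 1
  simp [triMat, Matrix.mul_apply, Fin.sum_univ_two] at h00 h01 h10 h11 ha ha' hb hb'
  generalize (M : Mat) 0 0 = p, (M : Mat) 0 1 = q, (M : Mat) 1 0 = r, (M : Mat) 1 1 = u at *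
  have hc : r = 0 := h10.resolve_right ha.ne'
  subst hc
  have hp : 0 < p := by
    by_contra! hneg
    have : p * a ≤ 0 := mul_nonpos_of_nonpos_of_nonneg hneg (by omega)
    omega
  have hp1 : p = 1 := by
    rcases Int.isUnit_iff.mp (IsUnit.of_mul_eq_one u (by linarith : p * u = 1)) with h | h <;> omega
  subst hp1
  have hu : u = 1 := by linarith
  subst hu
  have hq : q = 0 := by
    by_contra hne
    rcases lt_or_gt_of_ne hne with h | h <;> nlinarith
  subst hq
  simp only [Prod.mk.injEq]
  omega

theorem mem_triReps {s : ℕ} (hs : 0 < s) {t : ℕ × ℕ × ℕ} :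
    t ∈ triReps s ↔ 0 < t.1 ∧ 0 < t.2.2 ∧ t.1 * t.2.2 = s ∧
      Nat.gcd t.1 (Nat.gcd t.2.1 t.2.2) = 1 ∧ t.2.1 < t.2.2 := by
  simp only [triReps, Finset.mem_filter, Finset.mem_product, Finset.mem_range, and_iff_right_iff_imp]
  rintro ⟨h1, h2, h3, -, h5⟩
  have ha : t.1 ≤ s := Nat.le_of_dvd hs ⟨_, h3.symm⟩
  have hd : t.2.2 ≤ s := Nat.le_of_dvd hs ⟨t.1, by rw [mul_comm, h3]⟩
  omega

/-- The positive integers whose square divides `s`. -/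
def squareDivisors (s : ℕ) : Finset ℕ := (Finset.Icc 1 s).filter fun t => t ^ 2 ∣ s

theorem mem_squareDivisors {s t : ℕ} (hs : 0 < s) :
    t ∈ squareDivisors s ↔ 0 < t ∧ t ^ 2 ∣ s := by
  simp only [squareDivisors, Finset.mem_filter, Finset.mem_Icc]
  refine ⟨fun h => ⟨h.1.1, h.2⟩, fun h => ⟨⟨h.1, ?_⟩, h.2⟩⟩
  exact (Nat.le_self_pow two_ne_zero t).trans (Nat.le_of_dvd hs h.2)

theorem sum_card_triReps {s : ℕ} (hs : 0 < s) :
    ∑ t ∈ squareDivisors s, (triReps (s / t ^ 2)).card = ∑ d ∈ s.divisors, d := by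
  have hR : ∑ d ∈ s.divisors, d = (s.divisors.sigma fun d => Finset.range d).card := by
    simp
  rw [← Finset.card_sigma, hR]
  refine Finset.card_bij (fun x _ => ⟨x.1 * x.2.2.2, x.1 * x.2.2.1⟩) ?_ ?_ ?_
  · rintro ⟨t, a, b, d⟩ h
    rw [Finset.mem_sigma, mem_squareDivisors hs] at h
    obtain ⟨⟨ht, k, hk⟩, h⟩ := h
    have ht2 : 0 < t ^ 2 := by positivity
    have hk0 : 0 < k := Nat.pos_of_mul_pos_left (hk ▸ hs)
    simp only at h
    rw [hk, Nat.mul_div_cancel_left _ ht2, mem_triReps hk0] at h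
    obtain ⟨h1, h2, h3, h4, h5⟩ := h
    simp only [Finset.mem_sigma, Nat.mem_divisors, Finset.mem_range] at *
    refine ⟨⟨⟨t * a, by rw [hk, ← h3]; ring⟩, hs.ne'⟩, Nat.mul_lt_mul_of_pos_left h5 ht⟩
  · rintro ⟨t, a, b, d⟩ h ⟨t', a', b', d'⟩ h' heq
    have key : ∀ {t a b d : ℕ}, (⟨t, a, b, d⟩ : (_ : ℕ) × ℕ × ℕ × ℕ) ∈
        (squareDivisors s).sigma (fun t => triReps (s / t ^ 2)) →
        0 < t ∧ 0 < d ∧ s = (t * a) * (t * d) ∧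
          Nat.gcd (t * a) (Nat.gcd (t * b) (t * d)) = t := by
      intro t a b d h
      rw [Finset.mem_sigma, mem_squareDivisors hs] at h
      obtain ⟨⟨ht, k, hk⟩, h⟩ := h
      have ht2 : 0 < t ^ 2 := by positivity
      have hk0 : 0 < k := Nat.pos_of_mul_pos_left (hk ▸ hs)
      simp only at h
      rw [hk, Nat.mul_div_cancel_left _ ht2, mem_triReps hk0] at h
      obtain ⟨h1, h2, h3, h4, h5⟩ := h
      simp only at h1 h2 h3 h4 ht
      refine ⟨ht, h2, by rw [hk, ← h3]; ring, ?_⟩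
      rw [Nat.gcd_mul_left, Nat.gcd_mul_left, h4, mul_one]
    obtain ⟨ht, hd, hs1, hg⟩ := key h
    obtain ⟨ht', hd', hs1', hg'⟩ := key h'
    simp only [Sigma.mk.injEq, heq_eq_eq] at heq
    obtain ⟨e1, e2⟩ := heq
    have e3 : t * a = t' * a' := by
      apply Nat.eq_of_mul_eq_mul_right (Nat.mul_pos ht hd)
      rw [← hs1, e1, hs1']
    have e4 : t = t' := by rw [← hg, ← hg', e1, e2, e3]
    subst e4
    have e1 := Nat.eq_of_mul_eq_mul_left ht e1
    have e2 := Nat.eq_of_mul_eq_mul_left ht e2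
    have e3 := Nat.eq_of_mul_eq_mul_left ht e3
    subst e1 e2 e3
    rfl
  · rintro ⟨D, B⟩ h
    simp only [Finset.mem_sigma, Nat.mem_divisors, Finset.mem_range] at h
    obtain ⟨⟨⟨A, hA⟩, -⟩, hB⟩ := h
    have hD : 0 < D := by omega
    have hA0 : 0 < A := Nat.pos_of_mul_pos_left (hA ▸ hs)
    obtain ⟨t, ht⟩ : ∃ t, t = Nat.gcd A (Nat.gcd B D) := ⟨_, rfl⟩
    have ht0 : 0 < t := ht ▸ Nat.gcd_pos_of_pos_left _ hA0
    obtain ⟨a, ha⟩ : t ∣ A := ht ▸ Nat.gcd_dvd_left _ _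
    have hg : t ∣ Nat.gcd B D := ht ▸ Nat.gcd_dvd_right _ _
    obtain ⟨b, hb⟩ : t ∣ B := hg.trans (Nat.gcd_dvd_left _ _)
    obtain ⟨d, hd⟩ : t ∣ D := hg.trans (Nat.gcd_dvd_right _ _)
    have hs2 : s = t ^ 2 * (a * d) := by rw [hA, ha, hd]; ring
    subst ha hb hd
    have ha0 : 0 < a := Nat.pos_of_mul_pos_left hA0
    have hd0 : 0 < d := Nat.pos_of_mul_pos_left hD
    refine ⟨⟨t, a, b, d⟩, ?_, rfl⟩
    rw [Finset.mem_sigma, mem_squareDivisors hs]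
    refine ⟨⟨ht0, ⟨_, hs2⟩⟩, ?_⟩
    simp only
    rw [hs2, Nat.mul_div_cancel_left _ (by positivity), mem_triReps (by positivity)]
    refine ⟨ha0, hd0, rfl, ?_, Nat.lt_of_mul_lt_mul_left hB⟩
    rw [Nat.gcd_mul_left, Nat.gcd_mul_left] at ht
    exact Nat.eq_of_mul_eq_mul_left ht0 (by rw [← ht, mul_one])

theorem sq_mul_squarefree_unique {t e t' e' : ℕ} (ht : 0 < t) (ht' : 0 < t') (he : Squarefree e)
    (he' : Squarefree e') (h : t ^ 2 * e = t' ^ 2 * e') : t = t' ∧ e = e' := by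
  have e0 := he.ne_zero
  have e0' := he'.ne_zero
  have key : ∀ p, t.factorization p = t'.factorization p := by
    intro p
    have h1 := congrArg (fun n => n.factorization p) h
    rw [Nat.factorization_mul (by positivity) e0, Nat.factorization_mul (by positivity) e0',
      Nat.factorization_pow, Nat.factorization_pow] at h1
    simp only [Finsupp.coe_add, Finsupp.coe_smul, Pi.add_apply, Pi.smul_apply, smul_eq_mul] at h1
    have h2 := he.natFactorization_le_one p
    have h3 := he'.natFactorization_le_one p
    omega
  have htt : t = t' := Nat.eq_of_factorization_eq ht.ne' ht'.ne' key
  subst htt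
  exact ⟨rfl, Nat.eq_of_mul_eq_mul_left (by positivity) h⟩

theorem sum_psi {s : ℕ} (hs : 0 < s) :
    ∑ t ∈ squareDivisors s, psi (s / t ^ 2) = ∑ d ∈ s.divisors, d := by
  simp only [psi, ← Finset.sum_filter]
  rw [Finset.sum_sigma', ← Nat.sum_div_divisors s (fun d => d)]
  refine Finset.sum_bij (fun x _ => x.1 ^ 2 * x.2) ?_ ?_ ?_ ?_
  · rintro ⟨t, e⟩ h
    simp only [Finset.mem_sigma, mem_squareDivisors hs, Finset.mem_filter, Nat.mem_divisors] at h
    obtain ⟨⟨ht, k, hk⟩, ⟨⟨l, hl⟩, -⟩, -⟩ := h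
    rw [hk, Nat.mul_div_cancel_left _ (by positivity)] at hl
    rw [Nat.mem_divisors]
    exact ⟨⟨l, by simp only; rw [hk, hl, mul_assoc]⟩, hs.ne'⟩
  · rintro ⟨t, e⟩ h ⟨t', e'⟩ h' heq
    simp only [Finset.mem_sigma, mem_squareDivisors hs, Finset.mem_filter, Nat.mem_divisors] at h h'
    obtain ⟨h1, h2⟩ := sq_mul_squarefree_unique h.1.1 h'.1.1 h.2.2 h'.2.2 heq
    subst h1 h2
    rfl
  · intro n hn
    obtain ⟨⟨k, hk⟩, -⟩ := Nat.mem_divisors.mp hn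
    have hn0 : 0 < n := Nat.pos_of_mul_pos_right (hk ▸ hs)
    obtain ⟨e, t, he, ht, hte, hsq⟩ := Nat.sq_mul_squarefree_of_pos hn0
    refine ⟨⟨t, e⟩, ?_, hte⟩
    have hk0 : 0 < k := Nat.pos_of_mul_pos_left (hk ▸ hs)
    have hs2 : s = t ^ 2 * (e * k) := by rw [hk, ← hte, mul_assoc]
    simp only [Finset.mem_sigma, mem_squareDivisors hs, Finset.mem_filter, Nat.mem_divisors]
    refine ⟨⟨ht, _, hs2⟩, ⟨?_, ?_⟩, hsq⟩
    · rw [hs2, Nat.mul_div_cancel_left _ (by positivity)]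
      exact dvd_mul_right _ _
    · rw [hs2, Nat.mul_div_cancel_left _ (by positivity)]
      positivity
  · rintro ⟨t, e⟩ -
    exact Nat.div_div_eq_div_mul _ _ _

theorem card_triReps {s : ℕ} (hs : 0 < s) : (triReps s).card = psi s := by
  induction s using Nat.strong_induction_on with
  | _ s ih =>
    have h1 : 1 ∈ squareDivisors s := (mem_squareDivisors hs).mpr ⟨one_pos, by simp⟩
    have h2 := (sum_card_triReps hs).trans (sum_psi hs).symm
    rw [← Finset.add_sum_erase _ _ h1, ← Finset.add_sum_erase _ _ h1] at h2
    have h3 : ∑ t ∈ (squareDivisors s).erase 1, (triReps (s / t ^ 2)).card =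
        ∑ t ∈ (squareDivisors s).erase 1, psi (s / t ^ 2) := by
      refine Finset.sum_congr rfl fun t ht => ?_
      obtain ⟨ht1, ht2⟩ := Finset.mem_erase.mp ht
      obtain ⟨ht0, hdvd⟩ := (mem_squareDivisors hs).mp ht2
      have : 1 < t ^ 2 := Nat.one_lt_pow two_ne_zero (by omega)
      exact ih _ (Nat.div_lt_self hs this) (Nat.div_pos (Nat.le_of_dvd hs hdvd) (by omega))
    rw [h3] at h2
    simpa using h2

theorem isPrimitive_triMat_iff (t : ℕ × ℕ × ℕ) :
    (triMat t).IsPrimitive ↔ Nat.gcd t.1 (Nat.gcd t.2.1 t.2.2) = 1 := by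
  simp [Mat.IsPrimitive, triMat, Nat.gcd_assoc]

theorem exists_isOrbitReps {s : ℕ} (hs : 0 < s) : ∃ R : Fin (psi s) → Mat, IsOrbitReps s R := by
  have e : Fin (psi s) ≃ triReps s :=
    (finCongr (card_triReps hs).symm).trans (triReps s).equivFin.symm
  have hdet : ∀ t ∈ triReps s, (triMat t).det = s := by
    intro t ht
    rw [← ((mem_triReps hs).mp ht).2.2.1]
    simp [triMat, Matrix.det_fin_two]
  refine ⟨fun ν => triMat (e ν), fun ν => ⟨?_, hdet _ (e ν).2⟩, fun T hT hTdet => ?_⟩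
  · exact (isPrimitive_triMat_iff _).mpr ((mem_triReps hs).mp (e ν).2).2.2.2.1
  · obtain ⟨t, h1, h2, h3, h4, M, hM⟩ := exists_SL2Z_mul_triMat hs hTdet
    have hprim : (triMat t).IsPrimitive := by
      rw [← inv_mul_mul_SL2Z M (triMat t), ← hM]
      exact hT.SL2Z_mul _
    have ht : t ∈ triReps s :=
      (mem_triReps hs).mpr ⟨h1, h2, h3, (isPrimitive_triMat_iff t).mp hprim, h4⟩
    refine ⟨e.symm ⟨t, ht⟩, ⟨M, by simpa using hM⟩, ?_⟩
    rintro ν ⟨N, hN⟩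
    rw [Equiv.eq_symm_apply, Subtype.ext_iff]
    have hν := (mem_triReps hs).mp (e ν).2
    refine triMat_unique (M := N⁻¹ * M) h1 hν.1 h4 hν.2.2.2.2 ?_ |>.symm
    rw [Matrix.SpecialLinearGroup.coe_mul, mul_assoc, ← hM, hN, inv_mul_mul_SL2Z]

/-- `T` is the matrix of multiplication by `μ` with respect to the basis `z, 1`. -/
def MulMat (T : Mat) (z μ : ℂ) : Prop :=
  μ * z = (T 0 0 : ℂ) * z + (T 0 1 : ℂ) ∧ μ = (T 1 0 : ℂ) * z + (T 1 1 : ℂ)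

theorem MulMat.unique {S T : Mat} {z μ : ℂ} (hz : 0 < z.im) (hS : MulMat S z μ)
    (hT : MulMat T z μ) : S = T :=
  mat_eq_of_mulVec_eq hz (hS.1.symm.trans hT.1) (hS.2.symm.trans hT.2)

theorem MulMat.one (z : ℂ) : MulMat 1 z 1 := by simp [MulMat]

theorem MulMat.mul {S T : Mat} {z μ ν : ℂ} (hS : MulMat S z μ) (hT : MulMat T z ν) :
    MulMat (S * T) z (μ * ν) := by
  obtain ⟨h1, h2⟩ := hS
  obtain ⟨h3, h4⟩ := hT
  simp only [MulMat, Matrix.mul_apply, Fin.sum_univ_two]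
  push_cast
  constructor
  · linear_combination ν * h1 + (S 0 0 : ℂ) * h3 + (S 0 1 : ℂ) * h4
  · linear_combination ν * h2 + (S 1 0 : ℂ) * h3 + (S 1 1 : ℂ) * h4

theorem MulMat.det {T : Mat} {z μ : ℂ} (hz : 0 < z.im) (h : MulMat T z μ) :
    (T.det : ℝ) = normSq μ := by
  obtain ⟨h1, h2⟩ := h
  have r1 := congrArg Complex.re h1
  have i1 := congrArg Complex.im h1
  have r2 := congrArg Complex.re h2
  have i2 := congrArg Complex.im h2
  simp at r1 i1 r2 i2
  have h0 : μ.re + T 1 0 * z.re = T 0 0 := by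
    apply mul_right_cancel₀ hz.ne'
    linear_combination i1 - z.re * i2
  rw [Matrix.det_fin_two, normSq_apply]
  push_cast
  have h5 : (T 1 1 : ℝ) = μ.re - T 1 0 * z.re := by linear_combination -r2
  have h6 : (T 0 1 : ℝ) = μ.re * z.re - μ.im * z.im - T 0 0 * z.re := by linear_combination -r1
  rw [h5, h6, ← h0, i2]
  ring

theorem MulMat.moeb_eq {T : Mat} {z μ : ℂ} (h : MulMat T z μ) (hμ : μ ≠ 0) : moeb T z = z := by
  rw [moeb, ← h.1, ← h.2, mul_div_cancel_left₀ _ hμ]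

theorem mulMat_of_moeb_eq {T : Mat} {z : ℂ} (hT : T.det ≠ 0) (hz : 0 < z.im)
    (h : moeb T z = z) : MulMat T z ((T 1 0 : ℂ) * z + (T 1 1 : ℂ)) :=
  ⟨((moeb_eq_self_iff (denom_ne_zero_of_det hT hz)).1 h).symm, rfl⟩

theorem mem_order_iff_mulMat {K : Subfield ℂ} {O : Subring ℂ} {a b : ℂ}
    (hab : IsIdealBasis K O a b) {μ : ℂ} : μ ∈ O ↔ ∃ T : Mat, MulMat T (a / b) μ := by
  have hb : b ≠ 0 := by
    rintro rfl
    simpa using hab.1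
  rw [hab.2.2.2, zLat, AddSubgroup.mem_closure_pair, AddSubgroup.mem_closure_pair]
  simp only [zsmul_eq_mul]
  constructor
  · rintro ⟨⟨p, q, h1⟩, ⟨r, t, h2⟩⟩
    refine ⟨!![p, q; r, t], ?_, ?_⟩
    · simp only [Matrix.of_apply, Matrix.cons_val', Matrix.cons_val_zero, Matrix.cons_val_one,
        Matrix.cons_val_fin_one]
      field_simp
      linear_combination -h1
    · simp only [Matrix.of_apply, Matrix.cons_val', Matrix.cons_val_zero, Matrix.cons_val_one,
        Matrix.cons_val_fin_one]
      field_simp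
      linear_combination -h2
  · rintro ⟨T, h1, h2⟩
    refine ⟨⟨T 0 0, T 0 1, ?_⟩, ⟨T 1 0, T 1 1, ?_⟩⟩
    · field_simp at h1
      linear_combination -h1
    · field_simp at h2
      linear_combination -h2

theorem MulMat.isPrimElem_iff {K : Subfield ℂ} {O : Subring ℂ} {a b : ℂ}
    (hab : IsIdealBasis K O a b) {T : Mat} {μ : ℂ} (h : MulMat T (a / b) μ) :
    IsPrimElem O μ ↔ T.IsPrimitive := by
  have hO : μ ∈ O := (mem_order_iff_mulMat hab).2 ⟨T, h⟩
  rw [IsPrimElem, and_iff_right hO, Mat.isPrimitive_iff]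
  refine forall_congr' fun t => imp_congr_right fun ht => not_congr ?_
  have ht0 : (t : ℂ) ≠ 0 := by
    exact_mod_cast (by omega : t ≠ 0)
  rw [mem_order_iff_mulMat hab]
  constructor
  · rintro ⟨S, hS1, hS2⟩
    have hS : MulMat (t • S) (a / b) μ := by
      simp only [MulMat, Matrix.smul_apply, smul_eq_mul]
      push_cast
      rw [div_eq_iff ht0] at hS2
      rw [div_mul_eq_mul_div, div_eq_iff ht0] at hS1
      constructor
      · linear_combination hS1
      · linear_combination hS2
    intro i j
    rw [h.unique hab.1 hS]
    exact ⟨S i j, by simp⟩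
  · intro hd
    choose S hS using hd
    refine ⟨Matrix.of S, ?_, ?_⟩
    · have h1 := h.1
      rw [hS 0 0, hS 0 1] at h1
      push_cast at h1
      rw [div_mul_eq_mul_div, div_eq_iff ht0]
      simp only [Matrix.of_apply]
      linear_combination h1
    · have h2 := h.2
      rw [hS 1 0, hS 1 1] at h2
      push_cast at h2
      rw [div_eq_iff ht0]
      simp only [Matrix.of_apply]
      linear_combination h2

theorem moeb_SL2Z_eq_self_unit {K : Subfield ℂ} {O : Subring ℂ} {a b : ℂ}
    (hab : IsIdealBasis K O a b) {N : SL2Z} (h : moeb N (a / b) = a / b) :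
    ∃ ε, MulMat N (a / b) ε ∧ ε ∈ O ∧ ε ≠ 0 ∧ ε⁻¹ ∈ O := by
  have hinv : moeb (N⁻¹ : SL2Z) (a / b) = a / b := by
    conv_lhs => rw [← h]
    rw [← moeb_mul _ _ (denom_ne_zero_of_det (SL2Z_det_ne_zero N) hab.1),
      ← Matrix.SpecialLinearGroup.coe_mul, inv_mul_cancel, Matrix.SpecialLinearGroup.coe_one,
      moeb_one]
  have h1 := mulMat_of_moeb_eq (SL2Z_det_ne_zero N) hab.1 h
  have h2 := mulMat_of_moeb_eq (SL2Z_det_ne_zero N⁻¹) hab.1 hinv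
  have h3 := (h1.mul h2).2
  rw [← Matrix.SpecialLinearGroup.coe_mul, mul_inv_cancel, Matrix.SpecialLinearGroup.coe_one,
    ← (MulMat.one (a / b)).2] at h3
  refine ⟨_, h1, (mem_order_iff_mulMat hab).2 ⟨_, h1⟩, left_ne_zero_of_mul_eq_one h3, ?_⟩
  rw [← eq_inv_of_mul_eq_one_right h3]
  exact (mem_order_iff_mulMat hab).2 ⟨_, h2⟩

theorem exists_SL2Z_mulMat_of_unit {K : Subfield ℂ} {O : Subring ℂ} {a b : ℂ}
    (hab : IsIdealBasis K O a b) {ε : ℂ} (h1 : ε ∈ O) (h0 : ε ≠ 0) (h2 : ε⁻¹ ∈ O) :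
    ∃ N : SL2Z, MulMat N (a / b) ε := by
  obtain ⟨S, hS⟩ := (mem_order_iff_mulMat hab).1 h1
  obtain ⟨T, hT⟩ := (mem_order_iff_mulMat hab).1 h2
  have h3 := hS.mul hT
  rw [mul_inv_cancel₀ h0] at h3
  have h4 := congrArg Matrix.det (h3.unique hab.1 (MulMat.one _))
  rw [Matrix.det_mul, Matrix.det_one] at h4
  have h5 : 0 < S.det := by
    have := normSq_pos.2 h0
    rw [← hS.det hab.1] at this
    exact_mod_cast this
  exact ⟨⟨S, Int.eq_one_of_mul_eq_one_right h5.le h4⟩, hS⟩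

theorem card_fixed_eq_card_primElem {K : Subfield ℂ} {O : Subring ℂ} {a b : ℂ}
    (hab : IsIdealBasis K O a b) {s n : ℕ} (hs : 0 < s) {R : Fin n → Mat}
    (hR : IsOrbitReps s R) :
    Nat.card {ν // jC (moeb (R ν) (a / b)) = jC (a / b)} =
      Nat.card (Quot (fun μ μ' : {μ : ℂ // IsPrimElem O μ ∧ Complex.normSq μ = (s : ℝ)} =>
        UnitAssoc O μ.1 μ'.1)) := by
  have hz := hab.1
  have hRdet : ∀ ν, 0 < (R ν).det := fun ν => by
    rw [(hR.1 ν).2]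
    exact_mod_cast hs
  have hne : ∀ μ : {μ : ℂ // IsPrimElem O μ ∧ Complex.normSq μ = (s : ℝ)}, μ.1 ≠ 0 := by
    intro μ h
    have hμ := μ.2.2
    rw [h, map_zero] at hμ
    exact hs.ne (by exact_mod_cast hμ)
  have ex : ∀ μ : {μ : ℂ // IsPrimElem O μ ∧ Complex.normSq μ = (s : ℝ)},
      ∃ ν, ∃ M : SL2Z, MulMat (M * R ν) (a / b) μ.1 := by
    intro μ
    obtain ⟨T, hT⟩ := (mem_order_iff_mulMat hab).1 μ.2.1.1
    have hdet : T.det = s := by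
      have := hT.det hz
      rw [μ.2.2] at this
      exact_mod_cast this
    obtain ⟨ν, ⟨M, hM⟩, -⟩ := hR.2 T ((hT.isPrimElem_iff hab).1 μ.2.1) hdet
    exact ⟨ν, M, hM ▸ hT⟩
  have uniq : ∀ (M M' : SL2Z) (ν ν' : Fin n), (M : Mat) * R ν = M' * R ν' → ν = ν' := by
    intro M M' ν ν' h
    refine (hR.2 ((M : Mat) * R ν) ((hR.1 ν).1.SL2Z_mul M) ?_).unique ⟨M, rfl⟩ ⟨M', h⟩
    rw [det_SL2Z_mul, (hR.1 ν).2]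
  choose f M hf using ex
  have key : ∀ ν (N : SL2Z),
      moeb ((N : Mat) * R ν) (a / b) = moeb N (moeb (R ν) (a / b)) := fun ν N =>
    moeb_mul _ _ (denom_ne_zero_of_det (hRdet ν).ne' hz)
  have hfj : ∀ μ, jC (moeb (R (f μ)) (a / b)) = jC (a / b) := by
    intro μ
    rw [← jC_moeb (M μ) (moeb_im_pos (hRdet _) hz), ← key, (hf μ).moeb_eq (hne μ)]
  have hwd : ∀ μ μ' : {μ : ℂ // IsPrimElem O μ ∧ Complex.normSq μ = (s : ℝ)},
      UnitAssoc O μ.1 μ'.1 → f μ = f μ' := by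
    rintro μ μ' ⟨ε, h1, h0, h2, h⟩
    obtain ⟨N, hN⟩ := exists_SL2Z_mulMat_of_unit hab h1 h0 h2
    have h3 := hN.mul (hf μ)
    rw [← h, ← mul_assoc, ← Matrix.SpecialLinearGroup.coe_mul] at h3
    exact uniq _ _ _ _ (h3.unique hz (hf μ'))
  have hinj : ∀ μ μ' : {μ : ℂ // IsPrimElem O μ ∧ Complex.normSq μ = (s : ℝ)},
      f μ = f μ' → UnitAssoc O μ.1 μ'.1 := by
    intro μ μ' h
    have h2 : (((M μ' * (M μ)⁻¹ : SL2Z) : Mat)) * ((M μ : Mat) * R (f μ)) = M μ' * R (f μ') := by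
      rw [Matrix.SpecialLinearGroup.coe_mul, Matrix.mul_assoc, inv_mul_mul_SL2Z, h]
    have hfix : moeb (M μ' * (M μ)⁻¹ : SL2Z) (a / b) = a / b := by
      have h3 := (hf μ').moeb_eq (hne μ')
      rwa [← h2, moeb_mul, (hf μ).moeb_eq (hne μ)] at h3
      rw [← (hf μ).2]
      exact hne μ
    obtain ⟨ε, hε, h1, h0, h1'⟩ := moeb_SL2Z_eq_self_unit hab hfix
    refine ⟨ε, h1, h0, h1', ?_⟩
    have h4 := hε.mul (hf μ)
    rw [h2] at h4
    rw [(hf μ').2, h4.2]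
  symm
  refine Nat.card_eq_of_bijective (Quot.lift (fun μ => ⟨f μ, hfj μ⟩) fun μ μ' h =>
    Subtype.ext (hwd μ μ' h)) ⟨?_, ?_⟩
  · rintro ⟨μ⟩ ⟨μ'⟩ h
    exact Quot.sound (hinj μ μ' (congrArg Subtype.val h))
  · rintro ⟨ν, hν⟩
    obtain ⟨N, hN⟩ := exists_moeb_eq_of_jC_eq (moeb_im_pos (hRdet ν) hz) hz hν
    rw [← key] at hN
    have hdet : ((N : Mat) * R ν).det = s := by rw [det_SL2Z_mul, (hR.1 ν).2]
    have hT := mulMat_of_moeb_eq (by rw [hdet]; exact_mod_cast hs.ne') hz hN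
    have hprim := (hT.isPrimElem_iff hab).2 ((hR.1 ν).1.SL2Z_mul N)
    have hnorm := hT.det hz
    rw [hdet] at hnorm
    refine ⟨Quot.mk _ ⟨_, hprim, by rw [← hnorm, Int.cast_natCast]⟩, Subtype.ext ?_⟩
    exact uniq _ _ _ _ ((hf ⟨_, hprim, by rw [← hnorm, Int.cast_natCast]⟩).unique hz hT)

/-- For an ideal class k of an order O of an imaginary quadratic field K
(represented by the ideal basis (a,b)) and s > 1, the multiplicity of j(k) as a root of
J_s(X,X) equals the number of primitive elements of O of norm s, counted up to units of O. -/
theorem stmt8 (K : Subfield ℂ) (O : Subring ℂ) (hK : IsImagQuad K) (hO : IsOrder K O)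
    (a b : ℂ) (hab : IsIdealBasis K O a b)
    (s : ℕ) (hs : 1 < s) (J : Polynomial (Polynomial ℤ)) (hJ : IsModularPoly s J) :
    ((diagPoly J).map (Int.castRingHom ℂ)).rootMultiplicity (jC (a / b)) =
      Nat.card (Quot (fun μ μ' : {μ : ℂ // IsPrimElem O μ ∧ Complex.normSq μ = (s : ℝ)} =>
        UnitAssoc O μ.1 μ'.1)) := by
  obtain ⟨R, hR⟩ := exists_isOrbitReps (s := s) (by omega)
  rw [rootMultiplicity_diagPoly hs hJ hR hab.1]
  exact card_fixed_eq_card_primElem hab (by omega) hR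

end
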